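/- arXiv:1810.05335 — 2 statements merged into one kernel-verified Lean document; each statement's English description precedes it below -/
import Mathlib

section
/- Separation of Variables: Suppose B0 and B1 are complete Boolean algebras, j : B0 → B1 is a surjective Boolean algebra homomorphism, λ is an infinite cardinal, and the filter D = j⁻¹({1}) on B0 is λ⁺-good. Suppose U1 is an ultrafilter on B1 and U0 = j⁻¹(U1) (an ultrafilter on B0 extending D). Then for every complete countable first-order theory T, U0 λ⁺-saturates T if and only if U1 λ⁺-saturates T. -/
open FirstOrder FirstOrder.Language Cardinal

namespace BVal

/-! ### Filters and ultrafilters on complete Boolean algebras -/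

variable {B : Type} [CompleteBooleanAlgebra B]

/-- A filter on a complete Boolean algebra. -/
def IsBFilter (D : Set B) : Prop :=
  ⊤ ∈ D ∧ ⊥ ∉ D ∧ (∀ a b : B, a ∈ D → a ≤ b → b ∈ D) ∧
    (∀ a b : B, a ∈ D → b ∈ D → a ⊓ b ∈ D)

/-- An ultrafilter on a complete Boolean algebra. -/
def IsBUltrafilter (U : Set B) : Prop :=
  IsBFilter U ∧ ∀ a : B, a ∈ U ∨ aᶜ ∈ U

/-- An antichain in a complete Boolean algebra: pairwise disjoint nonzero elements. -/
def IsBAntichain (S : Set B) : Prop :=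
  (∀ a ∈ S, a ≠ ⊥) ∧ S.Pairwise fun a b => a ⊓ b = ⊥

/-- `ccOf B` is the least cardinal `κ` such that every antichain of `B` has cardinality `< κ`. -/
noncomputable def ccOf (B : Type) [CompleteBooleanAlgebra B] : Cardinal :=
  sInf {κ : Cardinal | ∀ S : Set B, IsBAntichain S → Cardinal.mk S < κ}

/-! ### Regularity -/

/-- An `I`-quasiregular family: finite meets are nonzero, countably infinite meets are zero. -/
def IsQuasiregularFamily {I : Type} (a : I → B) : Prop :=
  (∀ s : Finset I, s.inf a ≠ ⊥) ∧
    ∀ J : Set I, J.Countable → J.Infinite → (⨅ i ∈ J, a i) = ⊥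

/-- An `I`-regular family: quasiregular, and the set of nonzero elements deciding
every member of the family is dense. -/
def IsRegularFamily {I : Type} (a : I → B) : Prop :=
  IsQuasiregularFamily a ∧
    ∀ b : B, b ≠ ⊥ → ∃ b' : B, b' ≠ ⊥ ∧ b' ≤ b ∧ ∀ i, b' ≤ a i ∨ b' ≤ (a i)ᶜ

/-- A filter `D` is `lam`-regular if it contains some `lam`-regular family. -/
def IsRegularFilter (D : Set B) (lam : Cardinal) : Prop :=
  ∃ a : Quotient.out lam → B, IsRegularFamily a ∧ ∀ α, a α ∈ D

/-! ### Boolean-valued structures -/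

/-- Plug the tuple `b` into the `Fin`-indexed free variables of the bounded formula `φ`,
relabelling the parameters along `e`. -/
def plugEmb {L : FirstOrder.Language.{0, 0}} {C D : Type} {k : ℕ} (φ : L.BoundedFormula C k)
    (e : C → D) (b : Fin k → D) : L.Formula D :=
  φ.toFormula.relabel (Sum.elim e b)

/-- Plug the tuple `b` into the `Fin`-indexed free variables of the bounded formula `φ`. -/
def plug {L : FirstOrder.Language.{0, 0}} {C : Type} {k : ℕ} (φ : L.BoundedFormula C k)
    (b : Fin k → C) : L.Formula C :=
  plugEmb φ id b

/-- The finite conjunction of a list of bounded formulas. -/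
def listConj {L : FirstOrder.Language.{0, 0}} {α : Type} {n : ℕ} :
    List (L.BoundedFormula α n) → L.BoundedFormula α n
  | [] => ⊤
  | φ :: l => φ ⊓ listConj l

/-- The axioms for a `B`-valued `L`-structure with carrier `C` and evaluation map `val`,
where formulas with parameters from `C` are encoded as `L.Formula C` (the parameters being
the free variables): logically valid formulas get value `⊤`, negation and conjunction are
respected, the value of an existential formula is the supremum of the values of its instances,
and distinct elements are not identified. -/
def IsBVal {L : FirstOrder.Language.{0, 0}} {C : Type} (val : L.Formula C → B) : Prop :=
  (∀ φ : L.Formula C,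
      (∀ (N : Type) [L.Structure N] [Nonempty N] (v : C → N), φ.Realize v) → val φ = ⊤) ∧
  (∀ φ : L.Formula C, val φ.not = (val φ)ᶜ) ∧
  (∀ φ ψ : L.Formula C, val (φ ⊓ ψ) = val φ ⊓ val ψ) ∧
  (∀ φ : L.BoundedFormula C 1, val φ.ex = ⨆ a : C, val (plug φ fun _ => a)) ∧
  (∀ a b : C, a ≠ b → val (Term.equal (Term.var a) (Term.var b)) < ⊤)

/-- Fullness of a `B`-valued structure: every existential value is attained. -/
def IsFull {L : FirstOrder.Language.{0, 0}} {C : Type} (val : L.Formula C → B) : Prop :=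
  ∀ φ : L.BoundedFormula C 1, ∃ a : C, val φ.ex = val (plug φ fun _ => a)

/-- The `B`-valued structure gives every sentence of `T` the value `⊤`. -/
def BModels {L : FirstOrder.Language.{0, 0}} {C : Type} (val : L.Formula C → B) (T : L.Theory) : Prop :=
  ∀ φ ∈ T, val (Formula.relabel (fun e : Empty => e.elim) φ) = ⊤

/-- `val` is a full `B`-valued model of `T`. -/
def IsFullBModel {L : FirstOrder.Language.{0, 0}} (T : L.Theory) {C : Type}
    (val : L.Formula C → B) : Prop :=
  IsBVal val ∧ IsFull val ∧ BModels val T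

/-- An elementary map between `B`-valued structures. -/
def ElemMap {L : FirstOrder.Language.{0, 0}} {C D : Type} (v : L.Formula C → B) (w : L.Formula D → B)
    (f : C → D) : Prop :=
  ∀ φ : L.Formula C, v φ = w (φ.relabel f)

/-- `lam⁺`-saturation for full `B`-valued models of `T`: elementary maps from models of
cardinality at most `lam` extend along elementary extensions. -/
def BSaturated {L : FirstOrder.Language.{0, 0}} (T : L.Theory) (lam : Cardinal) {C : Type}
    (val : L.Formula C → B) : Prop :=
  ∀ (C0 C1 : Type) (v0 : L.Formula C0 → B) (v1 : L.Formula C1 → B),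
    IsFullBModel T v0 → IsFullBModel T v1 → Cardinal.mk C1 ≤ lam →
    ∀ ι : C0 → C1, ElemMap v0 v1 ι →
    ∀ f : C0 → C, ElemMap v0 val f →
    ∃ g : C1 → C, ElemMap v1 val g ∧ g ∘ ι = f

/-- `lam⁺`-universality for full `B`-valued models of `T`. -/
def BUniversal {L : FirstOrder.Language.{0, 0}} (T : L.Theory) (lam : Cardinal) {C : Type}
    (val : L.Formula C → B) : Prop :=
  ∀ (C1 : Type) (v1 : L.Formula C1 → B), IsFullBModel T v1 → Cardinal.mk C1 ≤ lam →
    ∃ f : C1 → C, ElemMap v1 val f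

/-! ### Ordinary structures, specializations, ordinary saturation -/

/-- A bundled (nonempty) ordinary `L`-structure. -/
structure OrdStructure (L : FirstOrder.Language.{0, 0}) : Type 1 where
  carrier : Type
  [str : L.Structure carrier]
  [nonempty' : Nonempty carrier]

attribute [instance] OrdStructure.str OrdStructure.nonempty'

instance {L : FirstOrder.Language.{0, 0}} : CoeSort (OrdStructure L) Type :=
  ⟨OrdStructure.carrier⟩

/-- `(N, π)` is a specialization of the `B`-valued structure `val` at the ultrafilter `U`:
`π` is surjective and a formula holds in `N` of the images iff its value lies in `U`. -/
def IsSpecialization {L : FirstOrder.Language.{0, 0}} {C : Type} (val : L.Formula C → B) (U : Set B)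
    (N : Type) [L.Structure N] (π : C → N) : Prop :=
  Function.Surjective π ∧ ∀ φ : L.Formula C, (val φ ∈ U ↔ φ.Realize π)

/-- An ordinary structure `N` is `lam⁺`-saturated: every finitely satisfiable set of formulas
in one free variable with parameters from a subset of `N` of cardinality at most `lam`
is realized in `N`. -/
def OrdSaturated (L : FirstOrder.Language.{0, 0}) (lam : Cardinal) (N : Type) [L.Structure N] : Prop :=
  ∀ A : Set N, Cardinal.mk A ≤ lam →
    ∀ p : Set (L.BoundedFormula A 1),
      (∀ s : Finset (L.BoundedFormula A 1), ↑s ⊆ p →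
        ∃ b : N, ∀ φ ∈ s, BoundedFormula.Realize φ Subtype.val fun _ => b) →
      ∃ b : N, ∀ φ ∈ p, BoundedFormula.Realize φ Subtype.val fun _ => b

/-- The ultrafilter `U` on `B` `lam⁺`-saturates the theory `T`: for every `lam⁺`-saturated
full `B`-valued model of `T`, every specialization at `U` is `lam⁺`-saturated. -/
def Saturates {L : FirstOrder.Language.{0, 0}} (U : Set B) (T : L.Theory) (lam : Cardinal) : Prop :=
  ∀ (C : Type) (val : L.Formula C → B), IsFullBModel T val → BSaturated T lam val →
    ∀ (N : Type) [L.Structure N] (π : C → N), IsSpecialization val U N π →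
      OrdSaturated L lam N

/-! ### Distributions -/

/-- An `I`-distribution in `B`. -/
def IsDistribution {I : Type} (A : Finset I → B) : Prop :=
  A ∅ = ⊤ ∧ (∀ s, A s ≠ ⊥) ∧ ∀ s t : Finset I, s ⊆ t → A t ≤ A s

/-- A multiplicative distribution. -/
def MultiplicativeDist {I : Type} (A : Finset I → B) : Prop :=
  ∀ s : Finset I, A s = s.inf fun i => A {i}

/-- `A'` refines `A`. -/
def Refines {I : Type} (A' A : Finset I → B) : Prop :=
  ∀ s, A' s ≤ A s

/-- `A'` conservatively refines `A`. -/
def ConsRefines {I : Type} (A' A : Finset I → B) : Prop :=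
  ∀ s : Finset I, A' s = A s ⊓ s.inf fun i => A' {i}

/-- The distribution `A` lies in the filter `D`. -/
def InFilter {I : Type} (A : Finset I → B) (D : Set B) : Prop :=
  ∀ s, A s ∈ D

/-- `A` has a multiplicative refinement in `D`. -/
def HasMultRefinement {I : Type} (A : Finset I → B) (D : Set B) : Prop :=
  ∃ A' : Finset I → B, IsDistribution A' ∧ MultiplicativeDist A' ∧ InFilter A' D ∧ Refines A' A

/-- A filter `D` is `lam⁺`-good if every `lam`-distribution in `D` has a multiplicative
refinement in `D`. -/
def IsGoodFilter (D : Set B) (lam : Cardinal) : Prop :=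
  ∀ A : Finset (Quotient.out lam) → B, IsDistribution A → InFilter A D →
    HasMultRefinement A D

/-- A distribution is regular if the family of its values at singletons is regular. -/
def IsRegularDistribution {I : Type} (A : Finset I → B) : Prop :=
  IsRegularFamily fun i => A {i}

/-! ### Łoś maps and possibilities -/

/-- An `I`-sequence of formulas `φ_i(x̄, ȳ_i)`: `x̄` has length `n`, `ȳ_i` has length `m i`. -/
structure FormulaSeq (L : FirstOrder.Language.{0, 0}) (I : Type) : Type 1 where
  n : ℕ
  m : I → ℕ
  φ : ∀ i, L.Formula (Fin n ⊕ Fin (m i))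

/-- The formula `∃ x̄, ⋀_{i ∈ s} φ_i(x̄, ā_i)`, with parameters `a`. -/
noncomputable def losFormula {L : FirstOrder.Language.{0, 0}} {C I : Type} (Φ : FormulaSeq L I)
    (a : ∀ i, Fin (Φ.m i) → C) (s : Finset I) : L.Formula C :=
  BoundedFormula.exs (listConj (s.toList.map fun i =>
    BoundedFormula.relabel
      (fun v : Fin Φ.n ⊕ Fin (Φ.m i) =>
        Sum.elim (fun k => Sum.inr k) (fun j => Sum.inl (a i j)) v)
      (Φ.φ i)))

/-- `A` is a `(I, T, Φ)`-Łoś map. -/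
def IsLosMapFor {L : FirstOrder.Language.{0, 0}} (T : L.Theory) {I : Type} (A : Finset I → B)
    (Φ : FormulaSeq L I) : Prop :=
  ∃ (C : Type) (val : L.Formula C → B), IsFullBModel T val ∧
    ∃ a : ∀ i, Fin (Φ.m i) → C, ∀ s : Finset I, A s = val (losFormula Φ a s)

/-- `A` is a `(I, T)`-Łoś map. -/
def IsLosMap {L : FirstOrder.Language.{0, 0}} (T : L.Theory) {I : Type} (A : Finset I → B) : Prop :=
  ∃ Φ : FormulaSeq L I, IsLosMapFor T A Φ

/-- `A` is a `(I, T)`-Łoś map witnessed by a formula sequence whose `x̄` has length `k`. -/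
def IsLosMapOfArity {L : FirstOrder.Language.{0, 0}} (T : L.Theory) {I : Type} (A : Finset I → B)
    (k : ℕ) : Prop :=
  ∃ Φ : FormulaSeq L I, Φ.n = k ∧ IsLosMapFor T A Φ

/-- `A` is a `(I, T)`-possibility: it conservatively refines some `(I, T)`-Łoś map. -/
def IsPossibility {L : FirstOrder.Language.{0, 0}} (T : L.Theory) {I : Type} (A : Finset I → B) : Prop :=
  ∃ A0 : Finset I → B, IsDistribution A0 ∧ IsLosMap T A0 ∧ ConsRefines A A0

/-! ### Partial types -/

/-- `p` is a partial type over the `B`-valued structure `val`: each finite conjunction has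
nonzero existential value. -/
def IsPartialType {L : FirstOrder.Language.{0, 0}} {C : Type} (val : L.Formula C → B) {k : ℕ}
    (p : Set (L.BoundedFormula C k)) : Prop :=
  ∀ Γ : Finset (L.BoundedFormula C k), ↑Γ ⊆ p →
    val (BoundedFormula.exs (listConj Γ.toList)) ≠ ⊥

/-- `p` is a partial `U`-type over `val`: each finite conjunction has existential value in `U`. -/
def IsUType {L : FirstOrder.Language.{0, 0}} {C : Type} (val : L.Formula C → B) (U : Set B) {k : ℕ}
    (p : Set (L.BoundedFormula C k)) : Prop :=
  ∀ Γ : Finset (L.BoundedFormula C k), ↑Γ ⊆ p →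
    val (BoundedFormula.exs (listConj Γ.toList)) ∈ U

/-- The Łoś map of the partial type `p`, as a `p`-distribution. -/
noncomputable def losOfType {L : FirstOrder.Language.{0, 0}} {C : Type} (val : L.Formula C → B) {k : ℕ}
    (p : Set (L.BoundedFormula C k)) : Finset ↥p → B := fun Γ =>
  val (BoundedFormula.exs (listConj (Γ.toList.map Subtype.val)))

/-! ### Boolean ultrapowers -/

/-- The carrier of the Boolean ultrapower `M^B`: maximal antichains indexed by `M`. -/
def BUP (B : Type) [CompleteBooleanAlgebra B] (M : Type) : Type :=
  {a : M → B // (∀ m m' : M, m ≠ m' → a m ⊓ a m' = ⊥) ∧ (⨆ m, a m) = ⊤}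

/-- The evaluation map of the Boolean ultrapower `M^B`. -/
noncomputable def bupVal (B : Type) [CompleteBooleanAlgebra B] {L : FirstOrder.Language.{0, 0}}
    (M : Type) [L.Structure M] : L.Formula (BUP B M) → B := fun φ =>
  letI : DecidableEq (BUP B M) := Classical.decEq _
  ⨆ (w : BUP B M → M) (_ : φ.Realize w), φ.freeVarFinset.inf fun c => c.1 (w c)

/-- A bundled complete Boolean algebra. -/
structure CBA : Type 1 where
  carrier : Type
  [str : CompleteBooleanAlgebra carrier]

attribute [instance] CBA.str

instance : CoeSort CBA Type := ⟨CBA.carrier⟩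

end BVal

open BVal

namespace SV

/-- Extension theorem of Sikorski type, in the form of a compactness statement. -/
theorem sikorski {A : Type*} {B : Type*} [BooleanAlgebra A] [CompleteBooleanAlgebra B]
    (S0 : Set (A × B)) (htop : (⊤, ⊤) ∈ S0) (hinf : ∀ p ∈ S0, ∀ q ∈ S0, p ⊓ q ∈ S0)
    (hbot : ∀ p ∈ S0, p.1 = ⊥ → p.2 = ⊥) :
    ∃ h : A → B, h ⊤ = ⊤ ∧ (∀ a, h aᶜ = (h a)ᶜ) ∧ (∀ a b, h (a ⊓ b) = h a ⊓ h b) ∧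
      ∀ p ∈ S0, p.2 ≤ h p.1 := by
  obtain ⟨S, hS0, hS⟩ := zorn_subset_nonempty
    {S : Set (A × B) | (⊤, ⊤) ∈ S ∧ (∀ p ∈ S, ∀ q ∈ S, p ⊓ q ∈ S) ∧ (∀ p ∈ S, p.1 = ⊥ → p.2 = ⊥)}
    (by
      intro c hcS hc hne
      refine ⟨⋃₀ c, ⟨?_, ?_, ?_⟩, fun s hs => Set.subset_sUnion_of_mem hs⟩
      · obtain ⟨s, hs⟩ := hne
        exact ⟨s, hs, (hcS hs).1⟩
      · rintro p ⟨s, hs, hp⟩ q ⟨t, ht, hq⟩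
        rcases hc.total hs ht with h | h
        · exact ⟨t, ht, (hcS ht).2.1 p (h hp) q hq⟩
        · exact ⟨s, hs, (hcS hs).2.1 p hp q (h hq)⟩
      · rintro p ⟨s, hs, hp⟩
        exact (hcS hs).2.2 p hp)
    S0 ⟨htop, hinf, hbot⟩
  obtain ⟨hStop, hSinf, hSbot⟩ := hS.prop
  have key : ∀ r : A × B, (∀ p ∈ S, p.1 ⊓ r.1 = ⊥ → p.2 ⊓ r.2 = ⊥) → r ∈ S := by
    intro r hr
    have hmem : (S ∪ {x | ∃ p ∈ S, x = p ⊓ r}) ∈ {S : Set (A × B) | (⊤, ⊤) ∈ S ∧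
        (∀ p ∈ S, ∀ q ∈ S, p ⊓ q ∈ S) ∧ (∀ p ∈ S, p.1 = ⊥ → p.2 = ⊥)} := by
      refine ⟨Or.inl hStop, ?_, ?_⟩
      · rintro p (hp | ⟨p, hp, rfl⟩) q (hq | ⟨q, hq, rfl⟩)
        · exact Or.inl (hSinf p hp q hq)
        · exact Or.inr ⟨p ⊓ q, hSinf p hp q hq, (inf_assoc _ _ _).symm⟩
        · exact Or.inr ⟨p ⊓ q, hSinf p hp q hq, inf_right_comm _ _ _⟩
        · refine Or.inr ⟨p ⊓ q, hSinf p hp q hq, ?_⟩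
          rw [inf_inf_inf_comm, inf_idem]
      · rintro p (hp | ⟨p, hp, rfl⟩)
        · exact hSbot p hp
        · exact hr p hp
    have := hS.eq_of_subset hmem Set.subset_union_left
    rw [this]
    refine Or.inr ⟨(⊤, ⊤), hStop, ?_⟩
    ext <;> simp
  have up : ∀ a a' b b', (a, b) ∈ S → a ≤ a' → b' ≤ b → (a', b') ∈ S := by
    intro a a' b b' hab ha hb
    refine key _ fun p hp h => ?_
    have h1 := hSbot _ (hSinf p hp _ hab) (le_bot_iff.1 (le_trans (inf_le_inf_left _ ha) h.le))
    exact le_bot_iff.1 (le_trans (inf_le_inf_left _ hb) (le_of_eq h1))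
  let h : A → B := fun a => sSup {b | (a, b) ∈ S}
  have hmem : ∀ a, (a, h a) ∈ S := by
    intro a
    refine key _ fun p hp hpa => ?_
    simp only [h, inf_sSup_eq]
    simp only [iSup_eq_bot]
    intro b hb
    exact hSbot _ (hSinf p hp _ hb) hpa
  have hle : ∀ a b, (a, b) ∈ S → b ≤ h a := fun a b hab => le_sSup hab
  have hc : ∀ a, (aᶜ, (h a)ᶜ) ∈ S := by
    intro a
    refine key _ fun p hp hpa => ?_
    have : p.1 ≤ a := by
      have := disjoint_iff.2 hpa
      simpa using this.le_compl_right
    have h2 : p.2 ≤ h a := hle _ _ (up p.1 a p.2 p.2 hp this le_rfl)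
    exact disjoint_iff.1 (disjoint_compl_right.mono_left h2)
  refine ⟨h, ?_, ?_, ?_, ?_⟩
  · exact top_le_iff.1 (hle _ _ hStop)
  · intro a
    refine le_antisymm ?_ (hle _ _ (hc a))
    refine le_compl_iff_disjoint_left.2 (disjoint_iff.2 ?_)
    exact hSbot _ (hSinf _ (hmem a) _ (hmem aᶜ)) (by simp)
  · intro a b
    refine le_antisymm (le_inf ?_ ?_) ?_
    · exact hle _ _ (up _ _ _ _ (hmem (a ⊓ b)) inf_le_left le_rfl)
    · exact hle _ _ (up _ _ _ _ (hmem (a ⊓ b)) inf_le_right le_rfl)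
    · exact hle _ _ (hSinf _ (hmem a) _ (hmem b))
  · intro p hp
    exact hle _ _ (hS0 hp)

/-- A `B`-valuation of the formulas with variables in `C`, modulo the formulas valid in `N`. -/
structure TVal {L : FirstOrder.Language.{0, 0}} {B : Type} [CompleteBooleanAlgebra B]
    (N : Type) [L.Structure N] {C : Type} (w : L.Formula C → B) : Prop where
  valid : ∀ φ : L.Formula C, (∀ v : C → N, φ.Realize v) → w φ = ⊤
  neg : ∀ φ : L.Formula C, w φ.not = (w φ)ᶜ
  conj : ∀ φ ψ : L.Formula C, w (φ ⊓ ψ) = w φ ⊓ w ψ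

section basics

variable {L : FirstOrder.Language.{0, 0}} {B : Type} [CompleteBooleanAlgebra B]
  {N : Type} [L.Structure N] {C D X Y Z : Type}

theorem TVal.mono {w : L.Formula C → B} (hw : TVal N w) {φ ψ : L.Formula C}
    (h : ∀ v : C → N, φ.Realize v → ψ.Realize v) : w φ ≤ w ψ := by
  have h1 : w (φ ⊓ ψ.not).not = ⊤ := hw.valid _ (by
    intro v
    simp only [Formula.realize_not, Formula.realize_inf]
    exact fun h2 => h2.2 (h v h2.1))
  rw [hw.neg, hw.conj, hw.neg, compl_eq_top] at h1
  simpa using (disjoint_iff.2 h1).le_compl_right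

theorem TVal.congr {w : L.Formula C → B} (hw : TVal N w) {φ ψ : L.Formula C}
    (h : ∀ v : C → N, φ.Realize v ↔ ψ.Realize v) : w φ = w ψ :=
  le_antisymm (hw.mono fun v => (h v).1) (hw.mono fun v => (h v).2)

theorem TVal.disj {w : L.Formula C → B} (hw : TVal N w) {φ ψ : L.Formula C}
    (h : ∀ v : C → N, φ.Realize v → ¬ ψ.Realize v) : w φ ⊓ w ψ = ⊥ := by
  have : w φ ≤ w ψ.not := hw.mono (by simpa using h)
  rw [hw.neg] at this
  exact disjoint_iff.1 (le_compl_iff_disjoint_right.1 this)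

theorem TVal.top {w : L.Formula C → B} (hw : TVal N w) : w ⊤ = ⊤ :=
  hw.valid _ (by simp)

theorem TVal.bot {w : L.Formula C → B} (hw : TVal N w) : w ⊥ = ⊥ := by
  have := hw.neg ⊤
  rw [hw.top, compl_top] at this
  rw [← this]
  exact hw.congr (by simp)

theorem TVal.rr {w : L.Formula X → B} (hw : TVal N w) (φ : L.Formula C) (f : C → D) (g : D → X) :
    w ((φ.relabel f).relabel g) = w (φ.relabel (g ∘ f)) :=
  hw.congr fun v => by simp [Formula.realize_relabel, Function.comp_assoc]

theorem TVal.relabel_id {w : L.Formula X → B} (hw : TVal N w) (φ : L.Formula X) :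
    w (φ.relabel id) = w φ :=
  hw.congr fun v => by simp [Formula.realize_relabel]

theorem TVal.comap {w : L.Formula D → B} (hw : TVal N w) (f : C → D) :
    TVal N (fun φ : L.Formula C => w (φ.relabel f)) where
  valid φ h := hw.valid _ (by
    intro v
    rw [Formula.realize_relabel]
    exact h _)
  neg φ := by
    rw [← hw.neg]
    exact hw.congr (by simp)
  conj φ ψ := by
    rw [← hw.conj]
    exact hw.congr (by simp)

theorem exists_conj {ι : Type} (s : Finset ι) (σ : ι → L.Formula C) :
    ∃ χ : L.Formula C,
      (∀ (M : Type) [L.Structure M] (v : C → M), χ.Realize v ↔ ∀ i ∈ s, (σ i).Realize v) ∧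
      ∀ (B : Type) [CompleteBooleanAlgebra B] (N : Type) [L.Structure N] (w : L.Formula C → B),
        TVal N w → w χ = s.inf fun i => w (σ i) := by
  classical
  induction s using Finset.induction_on with
  | empty => exact ⟨⊤, by simp, fun B _ N _ w hw => by simpa using hw.top⟩
  | insert a s ha ih =>
    obtain ⟨χ, h1, h2⟩ := ih
    refine ⟨σ a ⊓ χ, ?_, ?_⟩
    · intro M _ v
      simp [h1 M v]
    · intro B _ N _ w hw
      rw [hw.conj, Finset.inf_insert, h2 B N w hw]

theorem exists_fin (ψ : L.Formula (Y ⊕ Z)) :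
    ∃ (F : Finset Y) (ψ0 : L.Formula (F ⊕ Z)), ∀ (M : Type) [L.Structure M]
      (v : Y ⊕ Z → M), ψ0.Realize (v ∘ Sum.map Subtype.val id) ↔ ψ.Realize v := by
  classical
  refine ⟨ψ.freeVarFinset.toLeft, BoundedFormula.restrictFreeVar ψ (fun a =>
    match a with
    | ⟨Sum.inl y, h⟩ => Sum.inl ⟨y, by simpa using h⟩
    | ⟨Sum.inr z, h⟩ => Sum.inr z), ?_⟩
  intro M _ v
  refine BoundedFormula.realize_restrictFreeVar v ?_
  rintro ⟨y | z, h⟩ <;> rfl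

theorem exists_ex (ψ : L.Formula (X ⊕ Y)) :
    ∃ θ : L.Formula X, ∀ (M : Type) [L.Structure M] [Nonempty M] (x : X → M),
      θ.Realize x ↔ ∃ y : Y → M, ψ.Realize (Sum.elim x y) := by
  classical
  obtain ⟨F, ψ0, h⟩ := exists_fin (ψ.relabel Sum.swap)
  refine ⟨(ψ0.relabel Sum.swap).iExs F, ?_⟩
  intro M _ _ x
  rw [Formula.realize_iExs]
  constructor
  · rintro ⟨y, hy⟩
    refine ⟨fun z => if hz : z ∈ F then y ⟨z, hz⟩ else Classical.arbitrary M, ?_⟩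
    have := (h M (Sum.elim (fun z => if hz : z ∈ F then y ⟨z, hz⟩ else Classical.arbitrary M) x)).1
      (by
        rw [Formula.realize_relabel] at hy
        convert hy using 1
        ext (a | a) <;> simp)
    rw [Formula.realize_relabel] at this
    convert this using 1
    ext (a | a) <;> simp
  · rintro ⟨y, hy⟩
    refine ⟨fun z => y z, ?_⟩
    have := (h M (Sum.elim y x)).2 (by
      rw [Formula.realize_relabel]
      convert hy using 1
      ext (a | a) <;> simp)
    rw [Formula.realize_relabel]
    convert this using 1
    ext (a | a) <;> simp

theorem exists_fv (φ : L.Formula C) : ∃ F : Finset C, ∀ (M : Type) [L.Structure M]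
    (v v' : C → M), (∀ c ∈ F, v c = v' c) → (φ.Realize v ↔ φ.Realize v') := by
  obtain ⟨F, ψ0, h⟩ := exists_fin (φ.relabel (Sum.inl : C → C ⊕ Empty))
  refine ⟨F, fun M _ v v' hv => ?_⟩
  have h1 := h M (Sum.elim v Empty.elim)
  have h2 := h M (Sum.elim v' Empty.elim)
  simp only [Formula.realize_relabel, Sum.elim_comp_inl] at h1 h2
  rw [← h1, ← h2]
  have : (Sum.elim v Empty.elim ∘ Sum.map Subtype.val id : F ⊕ Empty → M) =
      Sum.elim v' Empty.elim ∘ Sum.map Subtype.val id := by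
    ext (a | a)
    · exact hv a a.2
    · exact a.elim
  rw [this]

theorem TVal.relabel_congr {w : L.Formula C → B} (hw : TVal N w) (f g : D → C)
    (h : ∀ d, w (Term.equal (Term.var (f d)) (Term.var (g d))) = ⊤) (φ : L.Formula D) :
    w (φ.relabel f) = w (φ.relabel g) := by
  obtain ⟨F, hF⟩ := exists_fv φ
  obtain ⟨χ, h1, h2⟩ := exists_conj F
    (fun d => (Term.equal (Term.var (f d)) (Term.var (g d)) : L.Formula C))
  have hχ : w χ = ⊤ := by
    rw [h2 B N w hw]
    simp [h]
  have e1 : w (φ.relabel f) = w (φ.relabel f ⊓ χ) := by rw [hw.conj, hχ, inf_top_eq]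
  have e2 : w (φ.relabel g) = w (φ.relabel g ⊓ χ) := by rw [hw.conj, hχ, inf_top_eq]
  rw [e1, e2]
  refine hw.congr fun v => ?_
  simp only [Formula.realize_inf, Formula.realize_relabel]
  refine and_congr_left fun hv => hF N _ _ fun d hd => ?_
  have := (h1 N v).1 hv d hd
  simpa using this

end basics

end SV

namespace SV

section compactness

variable {L : FirstOrder.Language.{0, 0}} {B : Type} [CompleteBooleanAlgebra B]
  {N : Type} [L.Structure N] {C D X Y Z J : Type}

/-- A Boolean homomorphism from a power set algebra. -/
structure IsHom (h : Set J → B) : Prop where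
  top : h ⊤ = ⊤
  compl : ∀ a, h aᶜ = (h a)ᶜ
  inf : ∀ a b, h (a ⊓ b) = h a ⊓ h b

theorem IsHom.mono {h : Set J → B} (hh : IsHom h) {a b : Set J} (hab : a ⊆ b) : h a ≤ h b := by
  have : a ⊓ b = a := inf_eq_left.2 hab
  rw [← this, hh.inf]
  exact inf_le_right

theorem tval_of_hom {h : Set J → B} (hh : IsHom h) (ev : J → C → N) :
    TVal N (fun φ : L.Formula C => h {j | φ.Realize (ev j)}) where
  valid φ hv := by
    rw [← hh.top]
    congr 1
    ext j
    simp [hv]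
  neg φ := by
    rw [← hh.compl]
    congr 1
  conj φ ψ := by
    rw [← hh.inf]
    congr 1
    ext j
    simp

theorem TVal.eq_of_ge {w u : L.Formula C → B} (hw : TVal N w) (hu : TVal N u)
    (h : ∀ φ, u φ ≤ w φ) (φ : L.Formula C) : w φ = u φ := by
  refine le_antisymm ?_ (h φ)
  have := h φ.not
  rw [hw.neg, hu.neg] at this
  exact compl_le_compl_iff_le.1 this

theorem TVal.exists_hom [Nonempty N] {w : L.Formula C → B} (hw : TVal N w) :
    ∃ h : Set (C → N) → B, IsHom h ∧ ∀ φ : L.Formula C, h {v | φ.Realize v} = w φ := by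
  obtain ⟨h, h1, h2, h3, h4⟩ := sikorski
    {p : Set (C → N) × B | ∃ φ : L.Formula C, p = ({v | φ.Realize v}, w φ)}
    ⟨⊤, by
      rw [hw.top]
      congr 1
      ext v
      simp⟩
    (by
      rintro _ ⟨φ, rfl⟩ _ ⟨ψ, rfl⟩
      refine ⟨φ ⊓ ψ, ?_⟩
      rw [hw.conj]
      ext1
      · ext v
        simp
      · rfl)
    (by
      rintro _ ⟨φ, rfl⟩ hb
      rw [← hw.bot]
      refine hw.congr fun v => ?_
      have : v ∉ {v | φ.Realize v} := by
        rw [show {v | φ.Realize v} = (⊥ : Set (C → N)) from hb]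
        exact fun h => h
      simpa using this)
  have hh : IsHom h := ⟨h1, h2, h3⟩
  refine ⟨h, hh, fun φ => ?_⟩
  exact (tval_of_hom hh id).eq_of_ge hw (fun φ => h4 _ ⟨φ, rfl⟩) φ

theorem exists_ext [Nonempty N] {u : L.Formula X → B} (hu : TVal N u) {I : Type}
    (ψ : I → L.Formula (X ⊕ Y)) (b : I → B)
    (H : ∀ (s : Finset I) (θ : L.Formula X),
      (∀ (x : X → N) (y : Y → N), θ.Realize x → (∀ i ∈ s, (ψ i).Realize (Sum.elim x y)) → False) →
      u θ ⊓ s.inf b = ⊥) :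
    ∃ v : L.Formula (X ⊕ Y) → B, TVal N v ∧ (∀ φ : L.Formula X, v (φ.relabel Sum.inl) = u φ) ∧
      ∀ i, b i ≤ v (ψ i) := by
  classical
  obtain ⟨h, h1, h2, h3, h4⟩ := sikorski
    {p : Set (X ⊕ Y → N) × B | ∃ (θ : L.Formula X) (s : Finset I),
      p = ({v | θ.Realize (v ∘ Sum.inl) ∧ ∀ i ∈ s, (ψ i).Realize v}, u θ ⊓ s.inf b)}
    ⟨⊤, ∅, by
      rw [hu.top]
      ext1
      · ext v
        simp
      · simp⟩
    (by
      rintro _ ⟨φ, s, rfl⟩ _ ⟨φ', s', rfl⟩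
      refine ⟨φ ⊓ φ', s ∪ s', ?_⟩
      rw [hu.conj, Finset.inf_union]
      ext1
      · ext v
        simp only [Prod.mk_inf_mk, Set.mem_ofPred_eq, Formula.realize_inf, Finset.mem_union,
          Set.inf_eq_inter, Set.mem_inter_iff]
        constructor
        · rintro ⟨⟨a, b⟩, c, d⟩
          exact ⟨⟨a, c⟩, fun i hi => hi.elim (b i) (d i)⟩
        · rintro ⟨⟨a, c⟩, d⟩
          exact ⟨⟨a, fun i hi => d i (Or.inl hi)⟩, c, fun i hi => d i (Or.inr hi)⟩
      · exact inf_inf_inf_comm _ _ _ _)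
    (by
      rintro _ ⟨φ, s, rfl⟩ hb
      refine H s φ fun x y hx hy => ?_
      have : Sum.elim x y ∈ (⊥ : Set (X ⊕ Y → N)) := by
        rw [← show _ = (⊥ : Set (X ⊕ Y → N)) from hb]
        exact ⟨by simpa using hx, hy⟩
      exact this)
  have hh : IsHom h := ⟨h1, h2, h3⟩
  have hT : TVal N (fun φ : L.Formula (X ⊕ Y) => h {j | φ.Realize j}) := tval_of_hom hh id
  refine ⟨_, hT, ?_, ?_⟩
  · refine (hT.comap Sum.inl).eq_of_ge hu fun φ => ?_
    have := h4 _ ⟨φ, ∅, rfl⟩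
    simp only [Finset.inf_empty, inf_top_eq] at this
    refine this.trans (hh.mono ?_)
    rintro v ⟨hv, -⟩
    simpa [Formula.realize_relabel] using hv
  · intro i
    have := h4 _ ⟨⊤, {i}, rfl⟩
    simp only [Finset.inf_singleton, hu.top, top_inf_eq] at this
    refine this.trans (hh.mono ?_)
    rintro v ⟨-, hv⟩
    exact hv i (Finset.mem_singleton_self i)

theorem amalg [Nonempty N] {u : L.Formula C → B} (hu : TVal N u) (e : X → C)
    {v : L.Formula (X ⊕ Y) → B} (hv : TVal N v)
    (hc : ∀ φ : L.Formula X, v (φ.relabel Sum.inl) = u (φ.relabel e)) :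
    ∃ w : L.Formula (C ⊕ Y) → B, TVal N w ∧ (∀ φ : L.Formula C, w (φ.relabel Sum.inl) = u φ) ∧
      ∀ φ : L.Formula (X ⊕ Y), w (φ.relabel (Sum.map e id)) = v φ := by
  obtain ⟨w, hw, h1, h2⟩ := exists_ext (Y := Y) hu
    (fun φ : L.Formula (X ⊕ Y) => φ.relabel (Sum.map e id)) v (by
      intro s θ h
      obtain ⟨χ, hχ1, hχ2⟩ := exists_conj s (id : L.Formula (X ⊕ Y) → L.Formula (X ⊕ Y))
      have e1 := hχ2 B N v hv
      simp only [id] at e1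
      rw [← e1]
      obtain ⟨χ', hχ'⟩ := exists_ex χ
      have e2 : v χ ≤ u (χ'.relabel e) := by
        rw [← hc]
        refine hv.mono fun x hx => ?_
        rw [Formula.realize_relabel, hχ']
        refine ⟨x ∘ Sum.inr, ?_⟩
        rwa [Sum.elim_comp_inl_inr]
      refine le_bot_iff.1 (le_trans (inf_le_inf_left _ e2) (le_of_eq (hu.disj fun x hx hx' => ?_)))
      rw [Formula.realize_relabel, hχ'] at hx'
      obtain ⟨y, hy⟩ := hx'
      refine h x y hx fun i hi => ?_
      have := (hχ1 N _).1 hy i hi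
      rw [Formula.realize_relabel]
      rw [show Sum.elim x y ∘ Sum.map e id = Sum.elim (x ∘ e) y by ext (a | a) <;> rfl]
      exact this)
  refine ⟨w, hw, h1, ?_⟩
  exact (hw.comap _).eq_of_ge hv h2

/-- Fullness of valuations. -/
def FullW (N : Type) [L.Structure N] (w : L.Formula C → B) : Prop :=
  ∀ ψ : L.Formula (C ⊕ Fin 1), ∃ a : C, ∀ θ : L.Formula C,
    (∀ v : C → N, θ.Realize v → ∃ y : Fin 1 → N, ψ.Realize (Sum.elim v y)) →
      w θ ≤ w (ψ.relabel (Sum.elim id fun _ => a))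

theorem realize_ex1 {M : Type} [L.Structure M] (φ : L.BoundedFormula C 1) (v : C → M) :
    Formula.Realize φ.ex v ↔ ∃ y : Fin 1 → M, φ.toFormula.Realize (Sum.elim v y) := by
  rw [Formula.Realize, BoundedFormula.realize_ex]
  simp only [BoundedFormula.realize_toFormula, Sum.elim_comp_inl, Sum.elim_comp_inr]
  constructor
  · rintro ⟨a, ha⟩
    exact ⟨_, ha⟩
  · rintro ⟨y, hy⟩
    refine ⟨y 0, ?_⟩
    convert hy using 1
    ext i
    rw [show i = 0 from Fin.fin_one_eq_zero i]
    rfl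

theorem FullW.isFull {w : L.Formula C → B} (hw : TVal N w) (hf : FullW N w)
    (φ : L.BoundedFormula C 1) : ∃ a : C, w φ.ex = w (plug φ fun _ => a) := by
  obtain ⟨a, ha⟩ := hf φ.toFormula
  refine ⟨a, le_antisymm (ha _ fun v => (realize_ex1 φ v).1) (hw.mono fun v hv => ?_)⟩
  rw [realize_ex1]
  rw [plug, plugEmb, Formula.realize_relabel] at hv
  refine ⟨fun _ => v a, ?_⟩
  convert hv using 1
  ext (a | a) <;> simp

theorem fullW_of_isFull {w : L.Formula C → B} (hw : TVal N w) (hf : IsFull w) : FullW N w := by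
  intro ψ
  let φ : L.BoundedFormula C 1 := BoundedFormula.relabel (n := 1) (k := 0) id ψ
  have hφ : ∀ (v : C ⊕ Fin 1 → N), φ.toFormula.Realize v ↔ ψ.Realize v := by
    intro v
    rw [BoundedFormula.realize_toFormula, BoundedFormula.realize_relabel, Formula.Realize,
      iff_eq_eq]
    congr 1
    · ext (a | a) <;> rfl
    · exact Subsingleton.elim _ _
  obtain ⟨a, ha⟩ := hf φ
  refine ⟨a, fun θ hθ => ?_⟩
  calc w θ ≤ w φ.ex := hw.mono fun v hv => by
        rw [realize_ex1]
        obtain ⟨y, hy⟩ := hθ v hv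
        exact ⟨y, (hφ _).2 hy⟩
    _ = _ := ha
    _ ≤ _ := hw.mono fun v hv => by
        rw [plug, plugEmb, Formula.realize_relabel, hφ] at hv
        rwa [Formula.realize_relabel]

theorem mkModel {T : L.Theory} [Nonempty N] [N ⊨ T] {w : L.Formula C → B} (hw : TVal N w)
    (hf : FullW N w)
    (hs : ∀ a b : C, w (Term.equal (Term.var a) (Term.var b)) = ⊤ → a = b) :
    IsFullBModel T w := by
  refine ⟨⟨fun φ h => hw.valid φ (h N), hw.neg, hw.conj, fun φ => ?_, fun a b hab => ?_⟩,
    hf.isFull hw, fun φ hφ => hw.valid _ fun v => ?_⟩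
  · obtain ⟨a, ha⟩ := hf.isFull hw φ
    refine le_antisymm (ha.le.trans (le_iSup (fun a : C => w (plug φ fun _ => a)) a))
      (iSup_le fun b => hw.mono fun v hv => ?_)
    rw [realize_ex1]
    rw [plug, plugEmb, Formula.realize_relabel] at hv
    refine ⟨fun _ => v b, ?_⟩
    convert hv using 1
    ext (a | a) <;> simp
  · exact lt_top_iff_ne_top.2 fun h => hab (hs a b h)
  · rw [Formula.realize_relabel]
    have := Theory.realize_sentence_of_mem (M := N) T hφ
    rw [Sentence.Realize] at this
    convert this

theorem tval_of_model {T : L.Theory} (hT : T.IsComplete) [Nonempty N] [N ⊨ T]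
    {w : L.Formula C → B} (h : IsFullBModel T w) : TVal N w := by
  obtain ⟨⟨h1, h2, h3, -, -⟩, -, h5⟩ := h
  refine ⟨fun φ hφ => ?_, h2, h3⟩
  have himp : ∀ φ ψ : L.Formula C, w φ = ⊤ → w (φ ⊓ ψ.not).not = ⊤ → w ψ = ⊤ := by
    intro φ ψ e1 e2
    rw [h2, h3, h2, e1] at e2
    simpa using e2
  have key : ∀ (T0 : Finset L.Sentence) (φ : L.Formula C), (T0 : Set L.Sentence) ⊆ T →
      (∀ (M : Type) [L.Structure M] [Nonempty M] (v : C → M), (∀ σ ∈ T0, M ⊨ σ) → φ.Realize v) →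
      w φ = ⊤ := by
    classical
    intro T0
    induction T0 using Finset.induction_on with
    | empty => exact fun φ _ h => h1 φ fun M _ _ v => h M v (by simp)
    | insert σ s hσ ih =>
      intro φ hs h
      refine himp (Formula.relabel (fun e : Empty => e.elim) σ) φ (h5 σ (hs (by simp)))
        (ih _ (fun x hx => hs (by simp [show x ∈ s from hx])) ?_)
      intro M _ _ v hv
      rw [Formula.realize_not, Formula.realize_inf, Formula.realize_not]
      rintro ⟨a, b⟩
      refine b (h M v fun τ hτ => ?_)
      rcases Finset.mem_insert.1 hτ with rfl | hτ
      · rw [Formula.realize_relabel] at a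
        rw [Sentence.Realize]
        convert a
      · exact hv τ hτ
  obtain ⟨θ, hθ⟩ := exists_ex (X := Empty) (φ.not.relabel (Sum.inr : C → Empty ⊕ C))
  have hθ' : ∀ (M : Type) [L.Structure M] [Nonempty M],
      M ⊨ (Formula.not θ : L.Sentence) ↔ ∀ v : C → M, φ.Realize v := by
    intro M _ _
    rw [Sentence.Realize, Formula.realize_not, hθ]
    simp [Formula.realize_relabel]
  have h6 : T ⊨ᵇ (Formula.not θ : L.Sentence) :=
    (hT.realize_sentence_iff _ N).1 ((hθ' N).2 hφ)
  obtain ⟨T0, hT0, h7⟩ := Theory.models_iff_finset_models.1 h6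
  refine key T0 φ hT0 fun M _ _ v hM => ?_
  have : M ⊨ (T0 : L.Theory) := ⟨fun σ hσ => hM σ hσ⟩
  exact (hθ' M).1 (h7.realize_sentence M) v

end compactness

end SV

namespace SV

section models

variable {L : FirstOrder.Language.{0, 0}} {B : Type} [CompleteBooleanAlgebra B]
  {N : Type} [L.Structure N] {C D X Y Z J : Type}

/-- Saturation in terms of valuations. -/
def SatStar (N : Type) [L.Structure N] (lam : Cardinal.{0}) (w : L.Formula C → B) : Prop :=
  ∀ (X Y : Type) [Nonempty X] [Nonempty Y], Cardinal.mk X ≤ lam → Cardinal.mk Y ≤ lam →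
    ∀ (e : X → C) (v : L.Formula (X ⊕ Y) → B), TVal N v →
      (∀ φ : L.Formula X, v (φ.relabel Sum.inl) = w (φ.relabel e)) →
      ∃ g : Y → C, ∀ φ : L.Formula (X ⊕ Y), w (φ.relabel (Sum.elim e g)) = v φ

theorem exists_quot {T : L.Theory} [Nonempty N] [N ⊨ T] {w : L.Formula C → B} (hw : TVal N w)
    (hf : FullW N w) :
    ∃ (Q : Type) (q : C → Q) (r : Q → C), (∀ a, q (r a) = a) ∧
      IsFullBModel T (fun φ : L.Formula Q => w (φ.relabel r)) ∧
      (∀ c, w (Term.equal (Term.var (r (q c))) (Term.var c)) = ⊤) := by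
  let s : Setoid C :=
    { r := fun a b => w (Term.equal (Term.var a) (Term.var b)) = ⊤
      iseqv :=
        { refl := fun a => hw.valid _ (by simp)
          symm := fun {a b} h => by
            rw [← h]
            exact hw.congr (by simp [eq_comm])
          trans := fun {a b c} h1 h2 => by
            refine top_le_iff.1 ?_
            calc ⊤ = w (Term.equal (Term.var a) (Term.var b)) ⊓
                  w (Term.equal (Term.var b) (Term.var c)) := by rw [h1, h2, inf_top_eq]
              _ = w (Term.equal (Term.var a) (Term.var b) ⊓
                    Term.equal (Term.var b) (Term.var c)) := (hw.conj _ _).symm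
              _ ≤ _ := hw.mono (by
                intro v
                simp only [Formula.realize_inf, Formula.realize_equal, Term.realize_var]
                rintro ⟨h1, h2⟩
                exact h1.trans h2) } }
  let q : C → Quotient s := Quotient.mk s
  let r : Quotient s → C := Quotient.out
  have hqr : ∀ a, q (r a) = a := fun a => Quotient.out_eq a
  have hrq : ∀ c, w (Term.equal (Term.var (r (q c))) (Term.var c)) = ⊤ := fun c =>
    Quotient.exact (hqr (q c))
  refine ⟨Quotient s, q, r, hqr, ?_, hrq⟩
  refine mkModel (hw.comap r) ?_ ?_
  · intro ψ
    obtain ⟨a, ha⟩ := hf (ψ.relabel (Sum.map r id))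
    refine ⟨q a, fun θ hθ => ?_⟩
    calc w (θ.relabel r) ≤ _ := ha _ (by
          intro v hv
          rw [Formula.realize_relabel] at hv
          obtain ⟨y, hy⟩ := hθ _ hv
          refine ⟨y, ?_⟩
          rw [Formula.realize_relabel]
          convert hy using 1
          ext (a | a) <;> simp)
      _ = w (ψ.relabel (Sum.elim r fun _ => a)) := by
          rw [hw.rr]
          congr 2
          ext (a | a) <;> simp
      _ = w (ψ.relabel (Sum.elim r fun _ => r (q a))) := by
          refine hw.relabel_congr _ _ ?_ _
          rintro (b | b)
          · exact hw.valid _ (by simp)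
          · exact s.symm (hrq a)
      _ = _ := by
          beta_reduce
          rw [hw.rr]
          congr 2
          ext (a | a) <;> simp
  · intro a b h
    rw [← hqr a, ← hqr b]
    refine Quotient.sound ?_
    refine Eq.trans (hw.congr fun v => ?_) h
    simp [Formula.realize_relabel]

theorem SatStar.quot {lam : Cardinal.{0}} {w : L.Formula C → B} (hw : TVal N w)
    (hs : SatStar N lam w) {Q : Type} (q : C → Q) (r : Q → C) (hqr : ∀ a, q (r a) = a)
    (hrq : ∀ c, w (Term.equal (Term.var (r (q c))) (Term.var c)) = ⊤) :
    SatStar N lam (fun φ : L.Formula Q => w (φ.relabel r)) := by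
  intro X Y _ _ hX hY e v hv hc
  obtain ⟨g, hg⟩ := hs X Y hX hY (r ∘ e) v hv (fun φ => by rw [hc]; exact hw.rr _ _ _)
  refine ⟨q ∘ g, fun φ => ?_⟩
  rw [← hg]
  refine (hw.rr _ _ _).trans ?_
  refine hw.relabel_congr _ _ ?_ _
  rintro (b | b)
  · exact hw.valid _ (by simp)
  · exact hrq _

theorem exists_full [Nonempty N] {w : L.Formula C → B} (hw : TVal N w) :
    ∃ (C' : Type) (w' : L.Formula C' → B) (i : C → C'), TVal N w' ∧ FullW N w' ∧
      ∀ φ : L.Formula C, w' (φ.relabel i) = w φ := by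
  classical
  obtain ⟨h, hh, h1⟩ := hw.exists_hom
  let ev : (C → N) → ((C → N) → N) → N := fun v f => f v
  refine ⟨(C → N) → N, fun φ => h {j | φ.Realize (ev j)}, fun c v => v c, tval_of_hom hh ev, ?_, ?_⟩
  · intro ψ
    let f : (C → N) → N := fun v =>
      if H : ∃ y : Fin 1 → N, ψ.Realize (Sum.elim (ev v) y) then H.choose 0
      else Classical.arbitrary N
    refine ⟨f, fun θ hθ => hh.mono fun v hv => ?_⟩
    have H := hθ _ hv
    have hf : f v = H.choose 0 := dif_pos H
    have h2 := H.choose_spec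
    change Formula.Realize _ _
    rw [Formula.realize_relabel]
    convert h2 using 1
    ext (a | a)
    · rfl
    · rw [show a = 0 from Fin.fin_one_eq_zero a]
      exact hf
  · intro φ
    rw [← h1]
    refine congrArg h ?_
    ext v
    change Formula.Realize _ _ ↔ Formula.Realize _ _
    rw [Formula.realize_relabel]
    rfl

theorem card_formula (hL : L.card ≤ ℵ₀) {lam : Cardinal.{0}} (hlam : ℵ₀ ≤ lam)
    (hX : Cardinal.mk X ≤ lam) : Cardinal.mk (L.Formula X) ≤ lam := by
  have h1 : Cardinal.mk (L.Formula X) ≤ Cardinal.mk (Σ n, L.BoundedFormula X n) :=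
    Cardinal.mk_le_of_injective (f := fun φ : L.Formula X => (⟨0, φ⟩ : Σ n, L.BoundedFormula X n))
      (by
        intro a b hab
        simpa using hab)
  refine h1.trans (BoundedFormula.card_le.trans (max_le hlam ?_))
  simp only [Cardinal.lift_id]
  exact Cardinal.add_le_of_le hlam hX (hL.trans hlam)

theorem ls (hL : L.card ≤ ℵ₀) {lam : Cardinal.{0}} (hlam : ℵ₀ ≤ lam) {w : L.Formula C → B}
    (hw : TVal N w) (hf : FullW N w) (s : Set C) (hs : Cardinal.mk s ≤ lam) :
    ∃ S : Set C, s ⊆ S ∧ Cardinal.mk S ≤ lam ∧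
      FullW N (fun φ : L.Formula S => w (φ.relabel Subtype.val)) := by
  classical
  let L' : FirstOrder.Language.{0, 0} := ⟨fun n => L.Formula (Fin n ⊕ Fin 1), fun _ => Empty⟩
  choose F hF using hf
  let _ : L'.Structure C :=
    { funMap := fun {n} ψ x => F (Formula.relabel (L := L) (Sum.map x id) ψ)
      RelMap := fun {n} r _ => r.elim }
  refine ⟨Substructure.closure L' s, Substructure.subset_closure, ?_, ?_⟩
  · have h1 := Substructure.lift_card_closure_le (L := L') (s := s)
    simp only [Cardinal.lift_id] at h1
    refine h1.trans (max_le hlam (Cardinal.add_le_of_le hlam hs (le_trans ?_ hlam)))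
    have : ∀ n, Countable (L'.Functions n) := by
      intro n
      rw [← Cardinal.mk_le_aleph0_iff]
      exact card_formula (X := Fin n ⊕ Fin 1) hL le_rfl Cardinal.mk_le_aleph0
    exact Cardinal.mk_le_aleph0
  · intro ψ
    obtain ⟨G, ψ0, h0⟩ := exists_fin ψ
    let eq := G.equivFin
    let ψ1 : L.Formula (Fin G.card ⊕ Fin 1) := ψ0.relabel (Sum.map eq id)
    let x : Fin G.card → C := fun k => ((eq.symm k).1 : C)
    let a : C := F (ψ1.relabel (Sum.map x id))
    have hψ1 : ∀ (v : C → N) (y : Fin 1 → N), (ψ1.relabel (Sum.map x id)).Realize (Sum.elim v y) ↔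
        ψ.Realize (Sum.elim (v ∘ Subtype.val) y) := by
      intro v y
      rw [Formula.realize_relabel, Formula.realize_relabel, ← h0]
      have : (Sum.elim v y ∘ Sum.map x id) ∘ Sum.map eq id =
        Sum.elim (v ∘ Subtype.val) y ∘ Sum.map Subtype.val id := by
        ext (b | b)
        · simp [x]
        · rfl
      rw [this]
    have ha : a ∈ Substructure.closure L' s := by
      have := (Substructure.closure L' s).fun_mem (n := G.card) ψ1 x
        (fun k => (eq.symm k).1.2)
      exact this
    refine ⟨⟨a, ha⟩, fun θ hθ => ?_⟩
    calc w (θ.relabel Subtype.val) ≤ _ := hF (ψ1.relabel (Sum.map x id)) _ (by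
          intro v hv
          rw [Formula.realize_relabel] at hv
          obtain ⟨y, hy⟩ := hθ _ hv
          exact ⟨y, (hψ1 _ _).2 hy⟩)
      _ = _ := hw.congr (by
          intro v
          have e1 := hψ1 v (fun _ => v a)
          have l1 : ∀ χ : L.Formula (C ⊕ Fin 1), (χ.relabel (Sum.elim id fun _ => a)).Realize v ↔
              χ.Realize (Sum.elim v (fun _ : Fin 1 => v a)) := by
            intro χ
            rw [Formula.realize_relabel, iff_eq_eq]
            congr 1
            ext (b | b) <;> rfl
          refine (l1 _).trans (e1.trans ?_)
          rw [Formula.realize_relabel, Formula.realize_relabel, iff_eq_eq]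
          congr 1
          ext (b | b) <;> rfl)

end models

end SV

namespace SV

section models2

variable {L : FirstOrder.Language.{0, 0}} {B : Type} [CompleteBooleanAlgebra B]
  {N : Type} [L.Structure N] {C D X Y Z J : Type}

theorem sep_of_model {T : L.Theory} {w : L.Formula C → B} (h : IsFullBModel T w) (a b : C)
    (hab : w (Term.equal (Term.var a) (Term.var b)) = ⊤) : a = b := by
  by_contra hne
  exact (h.1.2.2.2.2 a b hne).ne hab

theorem model_sub {T : L.Theory} (hT : T.IsComplete) [Nonempty N] [N ⊨ T]
    {w : L.Formula C → B} (h : IsFullBModel T w) (S : Set C)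
    (hS : FullW N (fun φ : L.Formula S => w (φ.relabel Subtype.val))) :
    IsFullBModel T (fun φ : L.Formula S => w (φ.relabel Subtype.val)) := by
  have hw : TVal N w := tval_of_model hT h
  refine mkModel (hw.comap _) hS fun a b hab => Subtype.ext (sep_of_model h _ _ ?_)
  refine Eq.trans (hw.congr fun v => ?_) hab
  simp [Formula.realize_relabel]

theorem satStar_of_bsat (hL : L.card ≤ ℵ₀) {lam : Cardinal.{0}} (hlam : ℵ₀ ≤ lam)
    {T : L.Theory} (hT : T.IsComplete) [Nonempty N] [N ⊨ T]
    {val : L.Formula C → B} (h : IsFullBModel T val) (hs : BSaturated T lam val) :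
    SatStar N lam val := by
  intro X Y _ _ hX hY e v hv hc
  have hw : TVal N val := tval_of_model hT h
  obtain ⟨S, hsS, hSc, hSf⟩ := ls hL hlam hw (fullW_of_isFull hw h.2.1) (Set.range e)
    (Cardinal.mk_range_le.trans hX)
  have hu := model_sub hT h S hSf
  let e' : X → S := fun x => ⟨e x, hsS ⟨x, rfl⟩⟩
  obtain ⟨w1, hw1, hw1a, hw1b⟩ := amalg (hw.comap (Subtype.val : S → C)) e' hv (fun φ => by
    rw [hc]
    exact (hw.rr φ e' Subtype.val).symm)
  obtain ⟨C', w', i, hw', hf', hi⟩ := exists_full hw1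
  obtain ⟨Q, q, r, hqr, hQ, hrq⟩ := exists_quot (T := T) hw' hf'
  have hwQ : TVal N (fun φ : L.Formula Q => w' (φ.relabel r)) := hw'.comap r
  obtain ⟨S', hsS', hSc', hSf'⟩ := ls hL hlam hwQ (fullW_of_isFull hwQ hQ.2.1)
    (Set.range (q ∘ i)) (Cardinal.mk_range_le.trans (by
      rw [Cardinal.mk_sum, Cardinal.lift_id, Cardinal.lift_id]
      exact Cardinal.add_le_of_le hlam hSc hY))
  have hv1 := model_sub hT hQ S' hSf'
  let k : S ⊕ Y → S' := fun z => ⟨q (i z), hsS' ⟨z, rfl⟩⟩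
  have hk : ∀ {Z : Type} (f : Z → S ⊕ Y) (φ : L.Formula Z),
      w' (((φ.relabel (k ∘ f)).relabel Subtype.val).relabel r) = w1 (φ.relabel f) := by
    intro Z f φ
    rw [← hi, hw'.rr, hw'.rr, hw'.rr]
    refine hw'.relabel_congr _ _ (fun d => ?_) _
    exact hrq _
  obtain ⟨g, hg, hgι⟩ := hs S S' _ _ hu hv1 hSc' (k ∘ Sum.inl) (fun φ => by
    rw [hk, hw1a]) Subtype.val (fun φ => rfl)
  refine ⟨fun y => g (k (Sum.inr y)), fun φ => ?_⟩
  rw [← hw1b, ← hk]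
  refine Eq.trans ?_ (hg _).symm
  rw [hw.rr]
  congr 2
  ext (x | y)
  · exact (congrFun hgι (e' x)).symm
  · rfl

theorem bsat_of_satStar {lam : Cardinal.{0}}
    {T : L.Theory} (hT : T.IsComplete) [Nonempty N] [N ⊨ T]
    {val : L.Formula C → B} (h : IsFullBModel T val) (hs : SatStar N lam val) :
    BSaturated T lam val := by
  intro C0 C1 v0 v1 h0 h1 hc1 ι hι f hf
  have hw : TVal N val := tval_of_model hT h
  have hw0 : TVal N v0 := tval_of_model hT h0
  have hw1 : TVal N v1 := tval_of_model hT h1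
  have hne : Nonempty C0 := ⟨(h0.2.1 ⊤).choose⟩
  have hne1 : Nonempty C1 := ⟨(h1.2.1 ⊤).choose⟩
  have hinj : Function.Injective ι := by
    intro a b hab
    refine sep_of_model h0 _ _ ?_
    rw [hι]
    exact hw1.valid _ (by simp [Formula.realize_relabel, hab])
  have hc0 : Cardinal.mk C0 ≤ lam := (Cardinal.mk_le_of_injective hinj).trans hc1
  obtain ⟨g, hg⟩ := hs C0 C1 hc0 hc1 f (fun φ => v1 (φ.relabel (Sum.elim ι id)))
    (hw1.comap _) (fun φ => by
      rw [← hf, hι, hw1.rr]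
      rfl)
  have hg' : ElemMap v1 val g := by
    intro φ
    have := hg (φ.relabel Sum.inr)
    rw [hw.rr, hw1.rr, Sum.elim_comp_inr, Sum.elim_comp_inr, hw1.relabel_id] at this
    exact this.symm
  refine ⟨g, hg', ?_⟩
  ext c
  refine (sep_of_model h _ _ ?_).symm
  have := hg (Term.equal (Term.var (Sum.inl c)) (Term.var (Sum.inr (ι c))))
  rw [hw1.valid _ (by simp [Formula.realize_relabel])] at this
  refine Eq.trans (hw.congr fun v => ?_) this
  simp [Formula.realize_relabel]

end models2

end SV

namespace SV

section good

variable {L : FirstOrder.Language.{0, 0}} {B0 B1 : Type} [CompleteBooleanAlgebra B0]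
  [CompleteBooleanAlgebra B1] {N : Type} [L.Structure N] {C D X Y Z J : Type}

theorem tval_map {j : B0 → B1} (htop : j ⊤ = ⊤)
    (hinf : ∀ a b : B0, j (a ⊓ b) = j a ⊓ j b) (hcompl : ∀ a : B0, j aᶜ = (j a)ᶜ)
    {w : L.Formula C → B0} (hw : TVal N w) : TVal N (fun φ => j (w φ)) where
  valid φ h := by rw [hw.valid φ h, htop]
  neg φ := by rw [hw.neg, hcompl]
  conj φ ψ := by rw [hw.conj, hinf]

theorem mono_of_inf {j : B0 → B1} (hinf : ∀ a b : B0, j (a ⊓ b) = j a ⊓ j b) {a b : B0}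
    (h : a ≤ b) : j a ≤ j b := by
  rw [← inf_eq_left.2 h, hinf]
  exact inf_le_right

theorem fullW_map {j : B0 → B1} (hinf : ∀ a b : B0, j (a ⊓ b) = j a ⊓ j b)
    {w : L.Formula C → B0} (hf : FullW N w) : FullW N (fun φ => j (w φ)) := by
  intro ψ
  obtain ⟨a, ha⟩ := hf ψ
  exact ⟨a, fun θ hθ => mono_of_inf hinf (ha θ hθ)⟩

theorem satStar_map (hL : L.card ≤ ℵ₀) {lam : Cardinal.{0}} (hlam : ℵ₀ ≤ lam) [Nonempty N]
    {j : B0 → B1} (hsurj : Function.Surjective j) (hbot : j ⊥ = ⊥) (htop : j ⊤ = ⊤)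
    (hinf : ∀ a b : B0, j (a ⊓ b) = j a ⊓ j b) (hsup : ∀ a b : B0, j (a ⊔ b) = j a ⊔ j b)
    (hcompl : ∀ a : B0, j aᶜ = (j a)ᶜ) (hne : (⊥ : B1) ≠ ⊤)
    (hgood : IsGoodFilter (j ⁻¹' {⊤}) lam)
    {w : L.Formula C → B0} (hw : TVal N w) (hs : SatStar N lam w) :
    SatStar N lam (fun φ => j (w φ)) := by
  classical
  intro X Y _ _ hX hY e v hv hc
  have hΓ : Cardinal.mk (L.Formula (X ⊕ Y)) ≤ lam := card_formula hL hlam (by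
    rw [Cardinal.mk_sum, Cardinal.lift_id, Cardinal.lift_id]
    exact Cardinal.add_le_of_le hlam hX hY)
  obtain ⟨k, hk⟩ : ∃ k : Quotient.out lam → L.Formula (X ⊕ Y), Function.Surjective k := by
    have h1 : Cardinal.mk (L.Formula (X ⊕ Y)) ≤ Cardinal.mk (Quotient.out lam) := by
      rwa [Cardinal.mk_out]
    obtain ⟨f⟩ := (Cardinal.le_def _ _).1 h1
    have : Nonempty (L.Formula (X ⊕ Y)) := ⟨⊤⟩
    exact ⟨Function.invFun f, Function.invFun_surjective f.injective⟩
  choose b hb using fun i => hsurj (v (k i))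
  choose χ hχ1 hχ2 using fun s : Finset (Quotient.out lam) => exists_conj s k
  choose θ hθ using fun s => exists_ex (χ s)
  let E : Finset (Quotient.out lam) → B0 := fun s => w ((θ s).relabel e)
  let A : Finset (Quotient.out lam) → B0 := fun s =>
    s.powerset.inf fun t => (t.inf b)ᶜ ⊔ E t
  have hjinf : ∀ {ι : Type} (s : Finset ι) (f : ι → B0), j (s.inf f) = s.inf (j ∘ f) :=
    fun s f => Finset.apply_inf_eq_inf_comp j hinf htop
  have hjA : ∀ s, j (A s) = ⊤ := by
    intro s
    rw [hjinf]
    refine top_le_iff.1 (Finset.le_inf fun t _ => ?_)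
    rw [Function.comp_apply, hsup, hcompl, hjinf]
    have e1 : t.inf (j ∘ b) = v (χ t) := by
      rw [hχ2 t B1 N v hv]
      congr 1
      ext i
      exact hb i
    have e2 : v (χ t) ≤ j (E t) := by
      rw [show j (E t) = v ((θ t).relabel Sum.inl) from (hc (θ t)).symm]
      refine hv.mono fun x hx => ?_
      rw [Formula.realize_relabel, hθ]
      refine ⟨x ∘ Sum.inr, ?_⟩
      rwa [Sum.elim_comp_inl_inr]
    rw [e1]
    calc ⊤ = (v (χ t))ᶜ ⊔ v (χ t) := compl_sup_eq_top.symm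
      _ ≤ _ := sup_le_sup_left e2 _
  have hAd : IsDistribution A := by
    refine ⟨?_, fun s hs => hne ?_, fun s t hst => Finset.inf_mono (Finset.powerset_mono.2 hst)⟩
    · simp only [A, E, Finset.powerset_empty, Finset.inf_singleton, Finset.inf_empty, compl_top,
        bot_sup_eq]
      refine hw.valid _ fun x => ?_
      rw [Formula.realize_relabel, hθ]
      refine ⟨fun _ => Classical.arbitrary N, ?_⟩
      rw [hχ1]
      simp
    · rw [← hbot, ← hs]
      exact hjA s
  obtain ⟨A', hA'd, hA'm, hA'D, hA'r⟩ := hgood A hAd hjA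
  have hu := hw.comap e
  obtain ⟨v', hv', h1, h2⟩ := exists_ext hu k (fun i => b i ⊓ A' {i}) (by
    intro s θ' hθ'
    have e1 : (s.inf fun i => b i ⊓ A' {i}) ≤ E s := by
      have e2 : (s.inf fun i => b i ⊓ A' {i}) = s.inf b ⊓ A' s := by
        rw [hA'm s]
        exact Finset.inf_inf
      rw [e2]
      calc s.inf b ⊓ A' s ≤ s.inf b ⊓ ((s.inf b)ᶜ ⊔ E s) :=
            inf_le_inf_left _ ((hA'r s).trans
              (Finset.inf_le (f := fun t => (t.inf b)ᶜ ⊔ E t)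
                (Finset.mem_powerset.2 (Finset.Subset.refl s))))
        _ ≤ E s := by
            rw [inf_sup_left, inf_compl_self, bot_sup_eq]
            exact inf_le_right
    refine le_bot_iff.1 ((inf_le_inf_left _ e1).trans (le_of_eq (hu.disj fun x hx hx' => ?_)))
    rw [hθ] at hx'
    obtain ⟨y, hy⟩ := hx'
    exact hθ' x y hx ((hχ1 s N _).1 hy))
  obtain ⟨g, hg⟩ := hs X Y hX hY e v' hv' h1
  refine ⟨g, ?_⟩
  have hjw : TVal N (fun φ => j (w φ)) := tval_map htop hinf hcompl hw
  refine (hjw.comap (Sum.elim e g)).eq_of_ge hv fun φ => ?_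
  obtain ⟨i, rfl⟩ := hk φ
  beta_reduce
  rw [hg]
  calc v (k i) = j (b i ⊓ A' {i}) := by
        rw [hinf, hb, show j (A' {i}) = ⊤ from hA'D {i}, inf_top_eq]
    _ ≤ _ := mono_of_inf hinf (h2 i)

end good

end SV

namespace SV

/-- Names for the elements of a saturated model. -/
inductive Tr (ℓ D : Type) : Type
  | leaf : Tr ℓ D
  | node : (ℓ → Tr ℓ D) → D → ℓ → Tr ℓ D

section exist

variable {L : FirstOrder.Language.{0, 0}} {B : Type} [CompleteBooleanAlgebra B]
  {N : Type} [L.Structure N] {C D X Y Z J : Type}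

theorem exists_tval [Nonempty N] (C : Type) : ∃ w : L.Formula C → B, TVal N w := by
  obtain ⟨h, h1, h2, h3, -⟩ := sikorski ({(⊤, ⊤)} : Set (Set (C → N) × B)) rfl
    (by
      rintro _ rfl _ rfl
      simp)
    (by
      rintro _ rfl hb
      exact absurd (show (⊤ : Set (C → N)) = ⊥ from hb) top_ne_bot)
  exact ⟨_, tval_of_hom (⟨h1, h2, h3⟩ : IsHom h) id⟩

/-- Partial stages of the construction of a saturated model. -/
structure St (N : Type) [L.Structure N] (ℓ : Type)
    (p : Set (Tr ℓ (L.Formula (ℓ ⊕ ℓ) → B)) × (L.Formula (Tr ℓ (L.Formula (ℓ ⊕ ℓ) → B)) → B)) :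
    Prop where
  tval : TVal N p.2
  sub : ∀ e d i, Tr.node e d i ∈ p.1 → ∀ k, e k ∈ p.1
  sib : ∀ e d i i', Tr.node e d i ∈ p.1 → Tr.node e d i' ∈ p.1
  spec : ∀ e d i, Tr.node e d i ∈ p.1 → TVal N d →
    (∀ φ : L.Formula ℓ, d (φ.relabel Sum.inl) = p.2 (φ.relabel e)) →
    ∀ φ, p.2 (φ.relabel (Sum.elim e (Tr.node e d))) = d φ

/-- The order on stages. -/
def StLe {S : Type} (p q : Set S × (L.Formula S → B)) : Prop :=
  p.1 ⊆ q.1 ∧ ∀ (Z : Type) (f : Z → S), (∀ z, f z ∈ p.1) → ∀ φ : L.Formula Z,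
    p.2 (φ.relabel f) = q.2 (φ.relabel f)

set_option linter.unusedSectionVars false in
theorem StLe.trans {S : Type} {p q r : Set S × (L.Formula S → B)} (h : StLe p q)
    (h' : StLe q r) : StLe p r :=
  ⟨h.1.trans h'.1, fun Z f hf φ => (h.2 Z f hf φ).trans (h'.2 Z f (fun z => h.1 (hf z)) φ)⟩

set_option linter.unusedSectionVars false in
theorem StLe.refl {S : Type} (p : Set S × (L.Formula S → B)) : StLe p p :=
  ⟨subset_rfl, fun _ _ _ _ => rfl⟩

theorem chain_bound [Nonempty N] {S : Type} (c : Set (Set S × (L.Formula S → B)))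
    (hne : c.Nonempty) (hc : ∀ p ∈ c, ∀ q ∈ c, StLe p q ∨ StLe q p)
    (ht : ∀ p ∈ c, TVal N p.2) :
    ∃ u : L.Formula S → B, TVal N u ∧ ∀ p ∈ c, StLe p (⋃ q ∈ c, q.1, u) := by
  obtain ⟨h, h1, h2, h3, h4⟩ := sikorski
    {q : Set (S → N) × B | ∃ p ∈ c, ∃ φ : L.Formula p.1,
      q = ({v | (φ.relabel (Subtype.val : p.1 → S)).Realize v},
        p.2 (φ.relabel (Subtype.val : p.1 → S)))}
    (by
      obtain ⟨p, hp⟩ := hne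
      refine ⟨p, hp, ⊤, ?_⟩
      rw [(ht p hp).valid _ (by simp)]
      ext1
      · ext v
        simp
      · rfl)
    (by
      have key : ∀ p ∈ c, ∀ q ∈ c, StLe p q → ∀ (φ : L.Formula p.1) (ψ : L.Formula q.1),
          ∃ χ : L.Formula q.1, (({v : S → N | (φ.relabel (Subtype.val : p.1 → S)).Realize v},
            p.2 (φ.relabel (Subtype.val : p.1 → S))) : Set (S → N) × B) ⊓
            ({v | (ψ.relabel (Subtype.val : q.1 → S)).Realize v},
            q.2 (ψ.relabel (Subtype.val : q.1 → S))) =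
            ({v | (χ.relabel (Subtype.val : q.1 → S)).Realize v},
            q.2 (χ.relabel (Subtype.val : q.1 → S))) := by
        intro p hp q hq hpq φ ψ
        refine ⟨φ.relabel (Set.inclusion hpq.1) ⊓ ψ, ?_⟩
        ext1
        · ext v
          simp only [Prod.mk_inf_mk, Set.inf_eq_inter, Set.mem_inter_iff, Set.mem_ofPred_eq,
            Formula.realize_relabel, Formula.realize_inf]
          rfl
        · have e1 := ((ht q hq).comap Subtype.val).conj (φ.relabel (Set.inclusion hpq.1)) ψ
          have e2 := (ht q hq).rr φ (Set.inclusion hpq.1) Subtype.val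
          have e3 := hpq.2 _ _ (fun z : p.1 => z.2) φ
          refine Eq.trans ?_ e1.symm
          change _ ⊓ _ = _ ⊓ _
          rw [e2, e3]
          rfl
      rintro _ ⟨p, hp, φ, rfl⟩ _ ⟨q, hq, ψ, rfl⟩
      rcases hc p hp q hq with hpq | hpq
      · obtain ⟨χ, hχ⟩ := key p hp q hq hpq φ ψ
        exact ⟨q, hq, χ, hχ⟩
      · obtain ⟨χ, hχ⟩ := key q hq p hp hpq ψ φ
        refine ⟨p, hp, χ, ?_⟩
        rw [inf_comm]
        exact hχ)
    (by
      rintro _ ⟨p, hp, φ, rfl⟩ hb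
      rw [← (ht p hp).bot]
      refine (ht p hp).congr fun v => ?_
      have : v ∉ {v : S → N | (φ.relabel (Subtype.val : p.1 → S)).Realize v} := by
        rw [show {v : S → N | (φ.relabel (Subtype.val : p.1 → S)).Realize v} = ⊥ from hb]
        exact fun h => h
      simpa using this)
  have hu : TVal N (fun φ : L.Formula S => h {v | φ.Realize v}) :=
    tval_of_hom (⟨h1, h2, h3⟩ : IsHom h) id
  refine ⟨_, hu, fun p hp => ⟨Set.subset_biUnion_of_mem (u := fun q => q.1) hp, ?_⟩⟩
  intro Z f hf φ
  have e1 := (hu.comap (Subtype.val : p.1 → S)).eq_of_ge ((ht p hp).comap Subtype.val)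
    (fun φ => h4 _ ⟨p, hp, φ, rfl⟩) (φ.relabel fun z => ⟨f z, hf z⟩)
  have e2 := hu.rr φ (fun z => (⟨f z, hf z⟩ : p.1)) Subtype.val
  have e3 := (ht p hp).rr φ (fun z => (⟨f z, hf z⟩ : p.1)) Subtype.val
  exact e3.symm.trans (e1.symm.trans e2)

theorem exists_maxSt [Nonempty N] (ℓ : Type) [Nonempty ℓ] :
    ∃ p : Set (Tr ℓ (L.Formula (ℓ ⊕ ℓ) → B)) × (L.Formula (Tr ℓ (L.Formula (ℓ ⊕ ℓ) → B)) → B),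
      St N ℓ p ∧ ∀ q, St N ℓ q → StLe p q → StLe q p := by
  have hne : Nonempty {p : Set (Tr ℓ (L.Formula (ℓ ⊕ ℓ) → B)) ×
      (L.Formula (Tr ℓ (L.Formula (ℓ ⊕ ℓ) → B)) → B) // St N ℓ p} := by
    obtain ⟨u, hu⟩ := exists_tval (L := L) (B := B) (N := N) (Tr ℓ (L.Formula (ℓ ⊕ ℓ) → B))
    exact ⟨⟨(∅, u), hu, fun _ _ _ h => h.elim, fun _ _ _ _ h => h.elim, fun _ _ _ h => h.elim⟩⟩
  obtain ⟨m, hm⟩ := exists_maximal_of_nonempty_chains_bounded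
    (r := fun p q : {p : Set (Tr ℓ (L.Formula (ℓ ⊕ ℓ) → B)) ×
      (L.Formula (Tr ℓ (L.Formula (ℓ ⊕ ℓ) → B)) → B) // St N ℓ p} => StLe p.1 q.1)
    (by
      intro c hc hcne
      obtain ⟨u, hu, hcu⟩ := chain_bound (N := N) (Subtype.val '' c) (hcne.image _)
        (by
          rintro _ ⟨p, hp, rfl⟩ _ ⟨q, hq, rfl⟩
          by_cases hpq : p = q
          · subst hpq
            exact Or.inl (StLe.refl _)
          · exact hc hp hq hpq)
        (by
          rintro _ ⟨p, hp, rfl⟩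
          exact p.2.tval)
      refine ⟨⟨_, hu, ?_, ?_, ?_⟩, fun a ha => hcu _ ⟨a, ha, rfl⟩⟩
      · intro e d i hi k
        simp only [Set.mem_iUnion] at hi ⊢
        obtain ⟨q, hq, hi⟩ := hi
        obtain ⟨q, hqc, rfl⟩ := id hq
        exact ⟨q.1, hq, q.2.sub e d i hi k⟩
      · intro e d i i' hi
        simp only [Set.mem_iUnion] at hi ⊢
        obtain ⟨q, hq, hi⟩ := hi
        obtain ⟨q, hqc, rfl⟩ := id hq
        exact ⟨q.1, hq, q.2.sib e d i i' hi⟩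
      · intro e d i hi hd hdu φ
        simp only [Set.mem_iUnion] at hi
        obtain ⟨q, hq, hi⟩ := hi
        have hle := hcu q hq
        obtain ⟨q, hqc, rfl⟩ := hq
        rw [← q.2.spec e d i hi hd (fun φ => by
          rw [hdu, hle.2 _ _ (q.2.sub e d i hi)])]
        refine (hle.2 _ _ ?_ _).symm
        rintro (k | k)
        · exact q.2.sub e d i hi k
        · exact q.2.sib e d i k hi)
    (fun h h' => StLe.trans h h')
  exact ⟨m.1, m.2, fun q hq hmq => hm ⟨q, hq⟩ hmq⟩

theorem maxSt_univ [Nonempty N] (ℓ : Type) [Nonempty ℓ]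
    (p : Set (Tr ℓ (L.Formula (ℓ ⊕ ℓ) → B)) × (L.Formula (Tr ℓ (L.Formula (ℓ ⊕ ℓ) → B)) → B))
    (hp : St N ℓ p) (hmax : ∀ q, St N ℓ q → StLe p q → StLe q p)
    (t : Tr ℓ (L.Formula (ℓ ⊕ ℓ) → B)) : t ∈ p.1 := by
  classical
  induction t with
  | leaf =>
    refine (hmax (p.1 ∪ {Tr.leaf}, p.2) ⟨hp.tval, ?_, ?_, ?_⟩ ⟨Set.subset_union_left,
      fun _ _ _ _ => rfl⟩).1 (Or.inr rfl)
    · rintro e d i (h | h) k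
      · exact Or.inl (hp.sub e d i h k)
      · cases h
    · rintro e d i i' (h | h)
      · exact Or.inl (hp.sib e d i i' h)
      · cases h
    · rintro e d i (h | h)
      · exact hp.spec e d i h
      · cases h
  | node e d i ih =>
    by_contra hi
    have hni : ∀ i', Tr.node e d i' ∉ p.1 := fun i' h => hi (hp.sib _ _ _ _ h)
    have key : ∃ u' : L.Formula (Tr ℓ (L.Formula (ℓ ⊕ ℓ) → B)) → B, TVal N u' ∧
        (∀ (Z : Type) (f : Z → _), (∀ z, f z ∈ p.1) → ∀ φ : L.Formula Z,
          p.2 (φ.relabel f) = u' (φ.relabel f)) ∧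
        (TVal N d → (∀ φ : L.Formula ℓ, d (φ.relabel Sum.inl) = p.2 (φ.relabel e)) →
          ∀ φ, u' (φ.relabel (Sum.elim e (Tr.node e d))) = d φ) := by
      by_cases hd : TVal N d ∧ ∀ φ : L.Formula ℓ, d (φ.relabel Sum.inl) = p.2 (φ.relabel e)
      · obtain ⟨hd, hdu⟩ := hd
        let e' : ℓ → p.1 := fun k => ⟨e k, ih k⟩
        obtain ⟨w, hw, hw1, hw2⟩ := amalg (hp.tval.comap (Subtype.val : p.1 → _)) e' hd
          (fun φ => by
            rw [hdu]
            exact (hp.tval.rr φ e' Subtype.val).symm)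
        let m : p.1 ⊕ ℓ → Tr ℓ (L.Formula (ℓ ⊕ ℓ) → B) := Sum.elim Subtype.val (Tr.node e d)
        have hm : Function.Injective m := by
          rintro (a | a) (b | b) hab
          · exact congrArg Sum.inl (Subtype.ext hab)
          · exact absurd ((show a.1 = Tr.node e d b from hab) ▸ a.2) (hni b)
          · exact absurd ((show b.1 = Tr.node e d a from hab.symm) ▸ b.2) (hni a)
          · have : Tr.node e d a = Tr.node e d b := hab
            injection this with _ _ h3
            rw [h3]
        let r := Function.invFun m
        have hr : ∀ x, r (m x) = x := Function.leftInverse_invFun hm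
        refine ⟨fun φ => w (φ.relabel r), hw.comap r, ?_, fun _ _ φ => ?_⟩
        · intro Z f hf φ
          have e1 := hw1 (φ.relabel fun z => ⟨f z, hf z⟩)
          have e2 := hp.tval.rr φ (fun z => (⟨f z, hf z⟩ : p.1)) Subtype.val
          refine Eq.trans e2.symm (Eq.trans e1.symm ?_)
          beta_reduce
          rw [hw.rr, hw.rr]
          congr 2
          ext z
          exact (hr (Sum.inl ⟨f z, hf z⟩)).symm
        · beta_reduce
          rw [hw.rr, ← hw2]
          congr 2
          ext (k | k)
          · exact hr (Sum.inl (e' k))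
          · exact hr (Sum.inr k)
      · exact ⟨p.2, hp.tval, fun _ _ _ _ => rfl, fun h1 h2 => absurd ⟨h1, h2⟩ hd⟩
    obtain ⟨u', hu', hle, hspec⟩ := key
    refine hi ((hmax (p.1 ∪ Set.range (Tr.node e d), u') ⟨hu', ?_, ?_, ?_⟩
      ⟨Set.subset_union_left, hle⟩).1 (Or.inr ⟨i, rfl⟩))
    · rintro e1 d1 i1 (h | ⟨i2, h⟩) k
      · exact Or.inl (hp.sub e1 d1 i1 h k)
      · injection h with h1 h2 h3
        subst h1
        exact Or.inl (ih k)
    · rintro e1 d1 i1 i' (h | ⟨i2, h⟩)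
      · exact Or.inl (hp.sib e1 d1 i1 i' h)
      · injection h with h1 h2 h3
        subst h1 h2
        exact Or.inr ⟨i', rfl⟩
    · rintro e1 d1 i1 (h | ⟨i2, h⟩) hd hdu φ
      · rw [← hp.spec e1 d1 i1 h hd (fun φ => by
          rw [hdu]
          exact (hle _ _ (hp.sub e1 d1 i1 h) φ).symm)]
        refine (hle _ _ ?_ _).symm
        rintro (k | k)
        · exact hp.sub e1 d1 i1 h k
        · exact hp.sib e1 d1 i1 k h
      · injection h with h1 h2 h3
        subst h1 h2
        exact hspec hd (fun φ => by
          rw [hdu]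
          exact (hle _ _ ih φ).symm) φ

theorem exists_satStar [Nonempty N] {lam : Cardinal.{0}} (hlam : ℵ₀ ≤ lam) :
    ∃ (C : Type) (w : L.Formula C → B), Nonempty C ∧ TVal N w ∧ SatStar N lam w := by
  have hlne : Nonempty (Quotient.out lam) := by
    rw [← Cardinal.mk_ne_zero_iff, Cardinal.mk_out]
    exact (lt_of_lt_of_le Cardinal.aleph0_pos hlam).ne'
  obtain ⟨p, hp, hmax⟩ := exists_maxSt (L := L) (B := B) (N := N) (Quotient.out lam)
  have huniv := maxSt_univ _ p hp hmax
  refine ⟨_, p.2, ⟨Tr.leaf⟩, hp.tval, ?_⟩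
  intro X Y _ _ hX hY e v hv hc
  have hsur : ∀ X : Type, Nonempty X → Cardinal.mk X ≤ lam →
      ∃ (a : Quotient.out lam → X) (s : X → Quotient.out lam), ∀ x, a (s x) = x := by
    intro X _ hX
    have h1 : Cardinal.mk X ≤ Cardinal.mk (Quotient.out lam) := by
      rwa [Cardinal.mk_out]
    obtain ⟨f⟩ := (Cardinal.le_def _ _).1 h1
    exact ⟨Function.invFun f, f, Function.leftInverse_invFun f.injective⟩
  obtain ⟨a, sa, ha⟩ := hsur X inferInstance hX
  obtain ⟨b, sb, hb⟩ := hsur Y inferInstance hY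
  let d : L.Formula (Quotient.out lam ⊕ Quotient.out lam) → B :=
    fun φ => v (φ.relabel (Sum.map a b))
  have h1 := hp.spec (e ∘ a) d hlne.some (huniv _) (hv.comap _) (fun φ => by
    have e1 := hv.rr φ Sum.inl (Sum.map a b)
    have e2 := hc (φ.relabel a)
    rw [hv.rr, hp.tval.rr] at e2
    exact e1.trans e2)
  refine ⟨fun y => Tr.node (e ∘ a) d (sb y), fun φ => ?_⟩
  have e1 := h1 (φ.relabel (Sum.map sa sb))
  rw [hp.tval.rr] at e1
  have e2 := hv.rr φ (Sum.map sa sb) (Sum.map a b)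
  have e3 : Sum.map a b ∘ Sum.map sa sb = id := by
    ext (x | x)
    · simp [ha]
    · simp [hb]
  rw [e3, hv.relabel_id] at e2
  rw [← e2]
  refine Eq.trans ?_ e1
  refine congrArg (fun f => p.2 (φ.relabel f)) ?_
  ext (x | x)
  · simp [ha]
  · rfl

theorem SatStar.fullW [Nonempty N] {lam : Cardinal.{0}} (hlam : ℵ₀ ≤ lam) [Nonempty C]
    {w : L.Formula C → B} (hw : TVal N w) (hs : SatStar N lam w) : FullW N w := by
  intro ψ
  obtain ⟨F, ψ0, h0⟩ := exists_fin ψ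
  let e : Option F → C := fun o => o.elim (Classical.arbitrary C) Subtype.val
  let ψ1 : L.Formula (Option F ⊕ Fin 1) := ψ0.relabel (Sum.map some id)
  have hψ1 : ∀ (v : C → N) (y : Fin 1 → N), ψ1.Realize (Sum.elim (v ∘ e) y) ↔
      ψ.Realize (Sum.elim v y) := by
    intro v y
    rw [Formula.realize_relabel, ← h0, iff_eq_eq]
    congr 1
    ext (a | a) <;> rfl
  obtain ⟨θ1, hθ1⟩ := exists_ex ψ1
  have hu := hw.comap e
  obtain ⟨v, hv, hv1, hv2⟩ := exists_ext hu (fun _ : Unit => ψ1) (fun _ => w (θ1.relabel e)) (by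
    intro s θ hθ
    rcases Finset.eq_empty_or_nonempty s with rfl | hs
    · rw [← hu.bot, Finset.inf_empty, inf_top_eq]
      refine hu.congr fun x => ?_
      have := hθ x (fun _ => Classical.arbitrary N)
      simpa using this
    · rw [Finset.inf_const hs]
      refine hu.disj fun x hx hx' => ?_
      obtain ⟨y, hy⟩ := (hθ1 N x).1 hx'
      exact hθ x y hx fun _ _ => hy)
  have hX : Cardinal.mk (Option F) ≤ lam := (Cardinal.mk_le_aleph0).trans hlam
  have hY : Cardinal.mk (Fin 1) ≤ lam := (Cardinal.mk_le_aleph0).trans hlam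
  obtain ⟨g, hg⟩ := hs (Option F) (Fin 1) hX hY e v hv hv1
  refine ⟨g 0, fun θ hθ => ?_⟩
  calc w θ ≤ w (θ1.relabel e) := hw.mono fun x hx => by
        rw [Formula.realize_relabel, hθ1]
        obtain ⟨y, hy⟩ := hθ x hx
        exact ⟨y, (hψ1 _ _).2 hy⟩
    _ ≤ v ψ1 := hv2 ()
    _ = w (ψ1.relabel (Sum.elim e g)) := (hg ψ1).symm
    _ = _ := hw.congr fun x => by
        have e1 := hψ1 x (fun _ => x (g 0))
        rw [Formula.realize_relabel (φ := ψ1), Formula.realize_relabel (φ := ψ)]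
        have e2 : x ∘ Sum.elim e g = Sum.elim (x ∘ e) (fun _ => x (g 0)) := by
          ext (a | a)
          · rfl
          · rw [show a = 0 from Fin.fin_one_eq_zero a]
            rfl
        have e3 : x ∘ Sum.elim id (fun _ : Fin 1 => g 0) = Sum.elim x (fun _ => x (g 0)) := by
          ext (a | a) <;> rfl
        rw [e2, e3]
        exact e1

theorem exists_saturated {lam : Cardinal.{0}} (hlam : ℵ₀ ≤ lam)
    {T : L.Theory} (hT : T.IsComplete) (N : Type) [L.Structure N] [Nonempty N] [N ⊨ T] :
    ∃ (C : Type) (w : L.Formula C → B), IsFullBModel T w ∧ SatStar N lam w ∧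
      BSaturated T lam w := by
  obtain ⟨C, w, hC, hw, hs⟩ := exists_satStar (L := L) (B := B) (N := N) hlam
  obtain ⟨Q, q, r, hqr, hQ, hrq⟩ := exists_quot (T := T) hw (hs.fullW hlam hw)
  have hsQ := hs.quot hw q r hqr hrq
  exact ⟨Q, _, hQ, hsQ, bsat_of_satStar hT hQ hsQ⟩

end exist

end SV

namespace SV

section spec

variable {L : FirstOrder.Language.{0, 0}} {B : Type} [CompleteBooleanAlgebra B]
  {N : Type} [L.Structure N] {C D X Y Z J : Type}

theorem ultra_compl {U : Set B} (hU : IsBUltrafilter U) (a : B) : aᶜ ∈ U ↔ a ∉ U := by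
  obtain ⟨⟨h1, h2, h3, h4⟩, h5⟩ := hU
  constructor
  · intro ha hb
    refine h2 ?_
    rw [← inf_compl_self a]
    exact h4 _ _ hb ha
  · exact fun ha => (h5 a).resolve_left ha

theorem ultra_inf {U : Set B} (hU : IsBUltrafilter U) (a b : B) :
    a ⊓ b ∈ U ↔ a ∈ U ∧ b ∈ U := by
  obtain ⟨⟨h1, h2, h3, h4⟩, h5⟩ := hU
  exact ⟨fun h => ⟨h3 _ _ h inf_le_left, h3 _ _ h inf_le_right⟩, fun h => h4 _ _ h.1 h.2⟩

theorem exists_elem [Nonempty N] {U : Set B} (hU : IsBUltrafilter U) {w : L.Formula C → B}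
    (hw : TVal N w) : ∃ (P : Type) (_ : L.Structure P) (_ : Nonempty P) (i : C → P),
      ∀ φ : L.Formula C, w φ ∈ U ↔ φ.Realize i := by
  have hwU : TVal N (fun φ : L.Formula C => (w φ ∈ U : Prop)) :=
    { valid := fun φ h => by
        rw [hw.valid φ h]
        exact propext (iff_true_intro hU.1.1)
      neg := fun φ => by
        rw [hw.neg]
        exact propext (ultra_compl hU _)
      conj := fun φ ψ => by
        rw [hw.conj]
        exact propext (ultra_inf hU _ _) }
  obtain ⟨h, hh, h1⟩ := hwU.exists_hom
  let f : Filter (C → N) :=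
    { sets := {s | h s}
      univ_sets := by
        have := hh.top
        exact of_eq_true this
      sets_of_superset := fun {s t} hs hst => hh.mono hst hs
      inter_sets := fun {s t} hs ht => by
        have := hh.inf s t
        exact (iff_of_eq this).2 ⟨hs, ht⟩ }
  let u : Ultrafilter (C → N) := Ultrafilter.ofComplNotMemIff f (fun s => by
    have h2 : h sᶜ ↔ ¬ h s := iff_of_eq (hh.compl s)
    change ¬ h sᶜ ↔ h s
    rw [h2, not_not])
  refine ⟨(u : Filter (C → N)).Product (fun _ => N), inferInstance,
    ⟨((fun _ => Classical.arbitrary N : (C → N) → N) :)⟩,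
    fun c => ((fun v : C → N => v c) : (C → N) → N), fun φ => ?_⟩
  have key := Ultraproduct.realize_formula_cast (u := u) (M := fun _ => N) φ (fun c v => v c)
  exact Iff.trans (iff_of_eq (h1 φ)).symm key.symm

theorem exists_spec [Nonempty N] {U : Set B} (hU : IsBUltrafilter U) {w : L.Formula C → B}
    (hw : TVal N w) (hf : FullW N w) : ∃ (P : Type) (_ : L.Structure P) (π : C → P),
      IsSpecialization w U P π := by
  obtain ⟨P, _, _, i, hi⟩ := exists_elem hU hw
  have key : ∀ ψ : L.Formula (C ⊕ Fin 1), (∃ y : Fin 1 → P, ψ.Realize (Sum.elim i y)) →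
      ∃ c, ψ.Realize (Sum.elim i fun _ => i c) := by
    intro ψ hψ
    obtain ⟨θ, hθ⟩ := exists_ex ψ
    obtain ⟨c, hc⟩ := hf ψ
    refine ⟨c, ?_⟩
    have h1 : w θ ∈ U := (hi θ).2 ((hθ P i).2 hψ)
    have h2 := hU.1.2.2.1 _ _ h1 (hc θ fun v hv => (hθ N v).1 hv)
    rw [hi, Formula.realize_relabel] at h2
    convert h2 using 1
    ext (a | a) <;> rfl
  let S : L.Substructure P :=
    { carrier := Set.range i
      fun_mem := by
        intro n f x hx
        choose c hc using hx
        obtain ⟨b, hb⟩ := key (Term.equal (Term.func f fun k => Term.var (Sum.inl (c k)))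
          (Term.var (Sum.inr 0))) ⟨fun _ => Structure.funMap f x, by
            simp [Formula.realize_equal, hc]⟩
        refine ⟨b, ?_⟩
        simpa [Formula.realize_equal, hc] using hb.symm }
  have hS : S.IsElementary := by
    refine S.isElementary_of_exists fun n φ x a hφ => ?_
    choose c hc using fun k => (x k).2
    let g : Empty ⊕ Fin (n + 1) → C ⊕ Fin 1 :=
      Sum.elim (fun e => e.elim) (Fin.snoc (fun k => Sum.inl (c k)) (Sum.inr 0))
    have hg : ∀ y : Fin 1 → P, (φ.toFormula.relabel g).Realize (Sum.elim i y) ↔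
        φ.Realize default (Fin.snoc (Subtype.val ∘ x) (y 0)) := by
      intro y
      rw [Formula.realize_relabel, BoundedFormula.realize_toFormula, iff_eq_eq]
      congr 1
      · exact Subsingleton.elim _ _
      · ext k
        refine Fin.lastCases ?_ (fun k => ?_) k
        · simp [g]
        · simp [g, hc]
    obtain ⟨b, hb⟩ := key _ ⟨fun _ => a, (hg _).2 hφ⟩
    exact ⟨⟨i b, b, rfl⟩, (hg _).1 hb⟩
  let E : L.ElementarySubstructure P := ⟨S, hS⟩
  refine ⟨E, inferInstance, fun c => ⟨i c, c, rfl⟩, ?_, fun φ => ?_⟩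
  · rintro ⟨_, c, rfl⟩
    exact ⟨c, rfl⟩
  · rw [hi, ← E.subtype.map_formula]
    rfl

/-- A reformulation of saturation of ordinary structures. -/
def OSat (L : FirstOrder.Language.{0, 0}) (lam : Cardinal.{0}) (N : Type) [L.Structure N] : Prop :=
  ∀ (A : Type), Cardinal.mk A ≤ lam → ∀ (a : A → N) (p : Set (L.Formula (A ⊕ Fin 1))),
    (∀ s : Finset (L.Formula (A ⊕ Fin 1)), ↑s ⊆ p →
      ∃ b : N, ∀ φ ∈ s, φ.Realize (Sum.elim a fun _ => b)) →
    ∃ b : N, ∀ φ ∈ p, φ.Realize (Sum.elim a fun _ => b)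

theorem osat_of_ordSaturated {lam : Cardinal.{0}} (h : OrdSaturated L lam N) : OSat L lam N := by
  classical
  intro A hA a p hp
  let F : L.Formula (A ⊕ Fin 1) → L.BoundedFormula (Set.range a) 1 :=
    BoundedFormula.relabel (n := 1) (k := 0)
      (Sum.map (fun x => (⟨a x, x, rfl⟩ : Set.range a)) id)
  have hF : ∀ φ b, (F φ).Realize Subtype.val (fun _ => b) ↔
      φ.Realize (Sum.elim a fun _ => b) := by
    intro φ b
    rw [BoundedFormula.realize_relabel, Formula.Realize, iff_eq_eq]
    congr 1
    · ext (x | x) <;> rfl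
    · exact Subsingleton.elim _ _
  obtain ⟨b, hb⟩ := h (Set.range a) (Cardinal.mk_range_le.trans hA) (F '' p) (by
    intro s hs
    obtain ⟨t, ht, rfl⟩ := Finset.subset_set_image_iff.1 hs
    obtain ⟨b, hb⟩ := hp t ht
    refine ⟨b, fun φ hφ => ?_⟩
    obtain ⟨ψ, hψ, rfl⟩ := Finset.mem_image.1 hφ
    exact (hF _ _).2 (hb ψ hψ))
  exact ⟨b, fun φ hφ => (hF _ _).1 (hb _ ⟨φ, hφ, rfl⟩)⟩

theorem ordSaturated_of_osat {lam : Cardinal.{0}} (h : OSat L lam N) : OrdSaturated L lam N := by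
  classical
  intro A hA p hp
  have hF : ∀ (φ : L.BoundedFormula A 1) b, φ.toFormula.Realize (Sum.elim Subtype.val fun _ => b) ↔
      φ.Realize Subtype.val (fun _ => b) := by
    intro φ b
    rw [BoundedFormula.realize_toFormula]
    rfl
  obtain ⟨b, hb⟩ := h A hA Subtype.val (BoundedFormula.toFormula '' p) (by
    intro s hs
    obtain ⟨t, ht, rfl⟩ := Finset.subset_set_image_iff.1 hs
    obtain ⟨b, hb⟩ := hp t ht
    refine ⟨b, fun φ hφ => ?_⟩
    obtain ⟨ψ, hψ, rfl⟩ := Finset.mem_image.1 hφ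
    exact (hF _ _).2 (hb ψ hψ))
  exact ⟨b, fun φ hφ => (hF _ _).1 (hb _ ⟨φ, hφ, rfl⟩)⟩

theorem jep [Nonempty N] {lam : Cardinal.{0}} (hlam : ℵ₀ ≤ lam) [Nonempty C]
    {w : L.Formula C → B} (hw : TVal N w) (hs : SatStar N lam w)
    {val : L.Formula D → B} (hv : TVal N val) [Nonempty Z] (hZ : Cardinal.mk Z ≤ lam)
    (e : Z → D) : ∃ g : Z → C, ∀ φ : L.Formula Z, w (φ.relabel g) = val (φ.relabel e) := by
  let c : Unit → C := fun _ => Classical.arbitrary C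
  let e0 : Empty → Unit := fun x => x.elim
  let v : L.Formula (Empty ⊕ Z) → B := fun φ => val (φ.relabel (Sum.elim (fun x => x.elim) e))
  have hv' : TVal N v := hv.comap _
  have hdet : ∀ (w1 w2 : L.Formula Empty → B), TVal N w1 → TVal N w2 → ∀ φ, w1 φ = w2 φ := by
    intro w1 w2 h1 h2 φ
    by_cases hφ : ∀ x : Empty → N, φ.Realize x
    · rw [h1.valid φ hφ, h2.valid φ hφ]
    · have h3 : ∀ x : Empty → N, (φ.Realize x ↔ (⊥ : L.Formula Empty).Realize x) := by
        intro x
        push Not at hφ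
        obtain ⟨y, hy⟩ := hφ
        rw [Subsingleton.elim x y]
        simpa using hy
      rw [h1.congr h3, h2.congr h3, h1.bot, h2.bot]
  obtain ⟨w1, hw1, hw1a, hw1b⟩ := amalg (hw.comap c) e0 hv'
    (hdet _ _ (hv'.comap Sum.inl) ((hw.comap c).comap e0))
  obtain ⟨g, hg⟩ := hs Unit Z (Cardinal.mk_le_aleph0.trans hlam) hZ c w1 hw1 hw1a
  refine ⟨g, fun φ => ?_⟩
  have e1 := hg (φ.relabel Sum.inr)
  have e2 := hw1b (φ.relabel Sum.inr)
  rw [hw.rr, Sum.elim_comp_inr] at e1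
  rw [hw1.rr] at e2
  have e3 := hv.rr φ Sum.inr (Sum.elim (fun x : Empty => x.elim) e)
  rw [Sum.elim_comp_inr] at e3
  exact e1.trans (e2.trans e3)

theorem osat_transfer (hne : Nonempty N) {lam : Cardinal.{0}} (hlam : ℵ₀ ≤ lam) [Nonempty C]
    {U : Set B} {w : L.Formula C → B} (hw : TVal N w) (hs : SatStar N lam w)
    {P : Type} [L.Structure P] (π0 : C → P) (hπ0 : Function.Surjective π0)
    (hi0 : ∀ φ : L.Formula C, w φ ∈ U ↔ φ.Realize π0) (hP : OSat L lam P) [Nonempty D]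
    {val : L.Formula D → B} (hv : TVal N val) (hsv : SatStar N lam val)
    {M : Type} [L.Structure M] (π : D → M) (hπ : Function.Surjective π)
    (hi : ∀ φ : L.Formula D, val φ ∈ U ↔ φ.Realize π) : OSat L lam M := by
  intro A hA a p hp
  have hPne : Nonempty P := ⟨π0 (Classical.arbitrary C)⟩
  have hMne : Nonempty M := ⟨π (Classical.arbitrary D)⟩
  choose σ hσ using hπ
  let e : Option A → D := fun o => o.elim (Classical.arbitrary D) (σ ∘ a)
  have hae : π ∘ e ∘ some = a := by
    ext x
    exact hσ (a x)
  have hZ : Cardinal.mk (Option A) ≤ lam := by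
    rw [Cardinal.mk_option]
    exact Cardinal.add_le_of_le hlam hA (Cardinal.one_le_aleph0.trans hlam)
  obtain ⟨g, hg⟩ := jep hlam hw hs hv hZ e
  obtain ⟨b, hb⟩ := hP A hA (π0 ∘ g ∘ some) p (by
    intro s hsp
    obtain ⟨b, hb⟩ := hp s hsp
    obtain ⟨χ, hχ, -⟩ := exists_conj s (id : L.Formula (A ⊕ Fin 1) → _)
    obtain ⟨θ, hθ⟩ := exists_ex χ
    have h1 : θ.Realize a := (hθ M a).2 ⟨fun _ => b, (hχ M _).2 hb⟩
    have h2 : val ((θ.relabel some).relabel e) ∈ U := by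
      rw [hi, Formula.realize_relabel, Formula.realize_relabel, Function.comp_assoc, hae]
      exact h1
    rw [← hg, hi0, Formula.realize_relabel, Formula.realize_relabel, Function.comp_assoc, hθ] at h2
    obtain ⟨y, hy⟩ := h2
    refine ⟨y 0, fun φ hφ => ?_⟩
    have h3 : φ.Realize (Sum.elim (π0 ∘ g ∘ some) y) := (hχ P _).1 hy φ hφ
    have h4 : (fun _ => y 0) = y := by
      ext k
      rw [show k = 0 from Fin.fin_one_eq_zero k]
    rw [h4]
    exact h3)
  obtain ⟨c, rfl⟩ := hπ0 b
  obtain ⟨g', hg'⟩ := hsv (Option A) (Fin 1) hZ (Cardinal.mk_le_aleph0.trans hlam) e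
    (fun φ => w (φ.relabel (Sum.elim g fun _ => c))) (hw.comap _) (fun φ => by
      rw [← hg, hw.rr, Sum.elim_comp_inl])
  refine ⟨π (g' 0), fun φ hφ => ?_⟩
  have h1 := hb φ hφ
  have h2 := hg' (φ.relabel (Sum.map some id))
  have h3 : w ((φ.relabel (Sum.map some id)).relabel (Sum.elim g fun _ => c)) ∈ U := by
    rw [hi0, Formula.realize_relabel, Formula.realize_relabel]
    convert h1 using 1
    ext (x | x) <;> rfl
  rw [← h2, hi, Formula.realize_relabel, Formula.realize_relabel] at h3
  convert h3 using 1
  ext (x | x)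
  · exact (congrFun hae x).symm
  · rw [show x = 0 from Fin.fin_one_eq_zero x]
    rfl

end spec

section main

variable {B0 B1 : Type} [CompleteBooleanAlgebra B0] [CompleteBooleanAlgebra B1]

theorem main {j : B0 → B1} (hsurj : Function.Surjective j)
    (hbot : j ⊥ = ⊥) (htop : j ⊤ = ⊤)
    (hinf : ∀ a b : B0, j (a ⊓ b) = j a ⊓ j b)
    (hsup : ∀ a b : B0, j (a ⊔ b) = j a ⊔ j b)
    (hcompl : ∀ a : B0, j aᶜ = (j a)ᶜ)
    {lam : Cardinal.{0}} (hlam : ℵ₀ ≤ lam) (hgood : IsGoodFilter (j ⁻¹' {⊤}) lam)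
    {U1 : Set B1} (hU1 : IsBUltrafilter U1)
    {L : FirstOrder.Language.{0, 0}} (hL : L.card ≤ ℵ₀) {T : L.Theory} (hT : T.IsComplete) :
    Saturates (j ⁻¹' U1) T lam ↔ Saturates U1 T lam := by
  have hne : (⊥ : B1) ≠ ⊤ := fun h => hU1.1.2.1 (h ▸ hU1.1.1)
  obtain ⟨N⟩ := hT.1
  have hU0 : IsBUltrafilter (j ⁻¹' U1) := by
    refine ⟨⟨?_, ?_, ?_, ?_⟩, ?_⟩
    · change j ⊤ ∈ U1
      rw [htop]
      exact hU1.1.1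
    · change j ⊥ ∉ U1
      rw [hbot]
      exact hU1.1.2.1
    · exact fun a b ha hab => hU1.1.2.2.1 _ _ ha (mono_of_inf hinf hab)
    · intro a b ha hb
      change j (a ⊓ b) ∈ U1
      rw [hinf]
      exact hU1.1.2.2.2 _ _ ha hb
    · intro a
      change j a ∈ U1 ∨ j aᶜ ∈ U1
      rw [hcompl]
      exact hU1.2 _
  constructor
  · intro hsat C val hval hbs M _ π hπ
    have hv : TVal N val := tval_of_model hT hval
    have hsv : SatStar N lam val := satStar_of_bsat hL hlam hT hval hbs
    obtain ⟨C0, w0, hw0, hs0, hbs0⟩ := exists_saturated (B := B0) hlam hT N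
    have hv0 : TVal N w0 := tval_of_model hT hw0
    obtain ⟨P, _, π0, hπ0⟩ := exists_spec hU0 hv0 (fullW_of_isFull hv0 hw0.2.1)
    have hP := osat_of_ordSaturated (hsat C0 w0 hw0 hbs0 P π0 hπ0)
    have hC0 : Nonempty C0 := ⟨(hw0.2.1 ⊤).choose⟩
    have hC : Nonempty C := ⟨(hval.2.1 ⊤).choose⟩
    exact ordSaturated_of_osat (osat_transfer (U := U1) (inferInstance : Nonempty N) hlam
      (tval_map htop hinf hcompl hv0)
      (satStar_map hL hlam hsurj hbot htop hinf hsup hcompl hne hgood hv0 hs0) π0 hπ0.1 hπ0.2 hP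
      hv hsv π hπ.1 hπ.2)
  · intro hsat C val hval hbs M _ π hπ
    have hv : TVal N val := tval_of_model hT hval
    have hsv : SatStar N lam val := satStar_of_bsat hL hlam hT hval hbs
    have hjv : TVal N (fun φ => j (val φ)) := tval_map htop hinf hcompl hv
    have hsj := satStar_map hL hlam hsurj hbot htop hinf hsup hcompl hne hgood hv hsv
    obtain ⟨Q, q, r, hqr, hQ, hrq⟩ := exists_quot (T := T) hjv
      (fullW_map hinf (fullW_of_isFull hv hval.2.1))
    have hsQ := hsj.quot hjv q r hqr hrq
    refine hsat Q _ hQ (bsat_of_satStar hT hQ hsQ) M (π ∘ r) ⟨?_, fun φ => ?_⟩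
    · intro m
      obtain ⟨c, rfl⟩ := hπ.1 m
      refine ⟨q c, ?_⟩
      have h1 := (hπ.2 (Term.equal (Term.var (r (q c))) (Term.var c))).1 (by
        change j _ ∈ U1
        rw [hrq]
        exact hU1.1.1)
      simpa using h1
    · rw [← Formula.realize_relabel]
      exact hπ.2 _

end main

end SV


/-- **Separation of Variables** (Theorem 7.4). -/
theorem stmt14_separation_of_variables (B0 B1 : Type)
    [CompleteBooleanAlgebra B0] [CompleteBooleanAlgebra B1]
    (j : B0 → B1) (hsurj : Function.Surjective j)
    (hbot : j ⊥ = ⊥) (htop : j ⊤ = ⊤)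
    (hinf : ∀ a b : B0, j (a ⊓ b) = j a ⊓ j b)
    (hsup : ∀ a b : B0, j (a ⊔ b) = j a ⊔ j b)
    (hcompl : ∀ a : B0, j aᶜ = (j a)ᶜ)
    (lam : Cardinal) (hlam : ℵ₀ ≤ lam) (hgood : IsGoodFilter (j ⁻¹' {⊤}) lam)
    (U1 : Set B1) (hU1 : IsBUltrafilter U1) :
    ∀ (L : FirstOrder.Language.{0, 0}), L.card ≤ ℵ₀ →
      ∀ T : L.Theory, T.IsComplete →
        (Saturates (j ⁻¹' U1) T lam ↔ Saturates U1 T lam) := by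
  
  intro L hL T hT
  exact SV.main hsurj hbot htop hinf hsup hcompl hlam hgood hU1 hL hT
end

section
/- Suppose λ is an infinite cardinal and B is a complete Boolean algebra with an antichain of cardinality λ. Then there is a nonprincipal λ⁺-good ultrafilter on B. -/
open FirstOrder FirstOrder.Language Cardinal

open BVal

namespace KunenAux

open Filter

/-- The task `p` is decided by the filter `F`: either some value of `p` is rejected, or there is
a multiplicative refinement of `p`, coded by a map to finite sets. -/
def Decides {X Λ : Type} (p : Finset Λ → Set X) (F : Filter X) : Prop :=
  (∃ s, (p s)ᶜ ∈ F) ∨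
    ∃ t : X → Finset Λ, (∀ x, x ∈ p (t x) ∨ t x = ∅) ∧ ∀ α, {x | α ∈ t x} ∈ F

lemma Decides.mono {X Λ : Type} {p : Finset Λ → Set X} {F G : Filter X} (h : Decides p F)
    (hG : G ≤ F) : Decides p G := by
  rcases h with ⟨s, hs⟩ | ⟨t, ht, ht'⟩
  · exact Or.inl ⟨s, hG hs⟩
  · exact Or.inr ⟨t, ht, fun α => hG (ht' α)⟩

/-- The filter `F` is consistent with the family `f` outside of the set `R` of removed indices. -/
def Cons {X Λ Q : Type} (f : Q → X → Finset Λ) (F : Filter X) (R : Set Q) : Prop :=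
  ∀ Y ∈ F, ∀ D : Finset Q, (∀ A ∈ D, A ∉ R) → ∀ g : Q → Finset Λ,
    ∃ x ∈ Y, ∀ A ∈ D, f A x = g A

/-- An independent family indexed by `Set Λ`. -/
lemma exists_independent (Λ : Type) [Infinite Λ] :
    ∃ (X : Type) (f : Set Λ → X → Finset Λ), Cardinal.mk X = Cardinal.mk Λ ∧
      Cons f (⊤ : Filter X) ∅ := by
  classical
  refine ⟨Finset Λ × Finset (Finset Λ × Finset Λ),
    fun A x => (x.2.filter (fun q => q.1 = x.1.filter (· ∈ A))).sup Prod.snd, ?_, ?_⟩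
  · have h1 : Cardinal.mk (Finset Λ) = Cardinal.mk Λ := Cardinal.mk_finset_of_infinite Λ
    have h0 : ℵ₀ ≤ Cardinal.mk Λ := Cardinal.aleph0_le_mk Λ
    rw [Cardinal.mk_prod, Cardinal.mk_finset_of_infinite (Finset Λ × Finset Λ), Cardinal.mk_prod]
    simp only [Cardinal.lift_id, h1, Cardinal.mul_eq_self h0]
  · intro Y hY D _ g
    rw [Filter.mem_top] at hY
    subst hY
    have hsep : ∀ A A' : Set Λ, ∃ a : Λ, A ≠ A' → ¬ (a ∈ A ↔ a ∈ A') := by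
      intro A A'
      by_cases h : A = A'
      · exact ⟨Classical.arbitrary Λ, fun h' => (h' h).elim⟩
      · by_contra hcon
        push Not at hcon
        exact h (Set.ext fun a => (hcon a).2)
    choose w hw using hsep
    set s : Finset Λ := (D ×ˢ D).image (fun q => w q.1 q.2) with hs
    have hinj : ∀ A ∈ D, ∀ A' ∈ D, s.filter (· ∈ A) = s.filter (· ∈ A') → A = A' := by
      intro A hA A' hA' h
      by_contra hne
      apply hw A A' hne
      have hmem : w A A' ∈ s := by
        rw [hs, Finset.mem_image]
        exact ⟨(A, A'), Finset.mem_product.2 ⟨hA, hA'⟩, rfl⟩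
      have := Finset.ext_iff.1 h (w A A')
      simpa [Finset.mem_filter, hmem] using this
    refine ⟨(s, D.image (fun A => (s.filter (· ∈ A), g A))), trivial, ?_⟩
    intro A hA
    apply le_antisymm
    · apply Finset.sup_le
      rintro ⟨u, v⟩ hq
      simp only [Finset.mem_filter, Finset.mem_image, Prod.mk.injEq] at hq
      obtain ⟨⟨A', hA', hu, hv⟩, h2⟩ := hq
      have : A' = A := hinj A' hA' A hA (hu.trans h2)
      subst this
      exact hv.symm.le
    · refine Finset.le_sup (f := Prod.snd) (b := (s.filter (· ∈ A), g A)) ?_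
      rw [Finset.mem_filter]
      exact ⟨Finset.mem_image.2 ⟨A, hA, rfl⟩, rfl⟩

/-- One step of the construction. -/
lemma step {X Λ Q : Type} (f : Q → X → Finset Λ) (F : Filter X) (R : Set Q)
    (hC : Cons f F R) (hR : ∃ A, A ∉ R) (p : Finset Λ → Set X) (hp : Antitone p) :
    ∃ S : Filter X × Finset Q, S.1 ≤ F ∧ Cons f S.1 (R ∪ ↑S.2) ∧ Decides p S.1 := by
  classical
  by_cases h : ∃ s, ∃ Y ∈ F, ∃ D : Finset Q, (∀ A ∈ D, A ∉ R) ∧ ∃ g : Q → Finset Λ,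
      ∀ x ∈ Y, x ∈ p s → ¬ ∀ A ∈ D, f A x = g A
  · obtain ⟨s, Y, hY, D, hD, g, hg⟩ := h
    refine ⟨(F ⊓ 𝓟 {x | ∀ A ∈ D, f A x = g A}, D), inf_le_left, ?_, Or.inl ⟨s, ?_⟩⟩
    · intro Z hZ D' hD' g'
      rw [Filter.mem_inf_principal] at hZ
      obtain ⟨x, hx, hx'⟩ := hC _ hZ (D ∪ D') (by
        intro A hA
        rcases Finset.mem_union.1 hA with hA | hA
        · exact hD A hA
        · exact fun hAR => hD' A hA (Or.inl hAR)) (fun A => if A ∈ D then g A else g' A)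
      refine ⟨x, hx ?_, ?_⟩
      · intro A hA
        rw [hx' A (Finset.mem_union_left _ hA), if_pos hA]
      · intro A hA
        have : A ∉ D := fun hAD => hD' A hA (Or.inr hAD)
        rw [hx' A (Finset.mem_union_right _ hA), if_neg this]
    · rw [Filter.mem_inf_principal]
      filter_upwards [hY] with x hx hx' hps
      exact hg x hx hps hx'
  · push Not at h
    obtain ⟨A0, hA0⟩ := hR
    let t : X → Finset Λ := fun x => if x ∈ p (f A0 x) then f A0 x else ∅
    let F' : Filter X :=
      { sets := {Z | ∃ Y ∈ F, ∃ s : Finset Λ, ∀ x ∈ Y, s ⊆ t x → x ∈ Z}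
        univ_sets := ⟨Set.univ, Filter.univ_mem, ∅, fun _ _ _ => trivial⟩
        sets_of_superset := by
          rintro Z Z' ⟨Y, hY, s, h⟩ hZ
          exact ⟨Y, hY, s, fun x hx hs => hZ (h x hx hs)⟩
        inter_sets := by
          rintro Z Z' ⟨Y, hY, s, h⟩ ⟨Y', hY', s', h'⟩
          exact ⟨Y ∩ Y', Filter.inter_mem hY hY', s ∪ s', fun x hx hs =>
            ⟨h x hx.1 (Finset.union_subset_left hs), h' x hx.2 (Finset.union_subset_right hs)⟩⟩ }
    have hF' : ∀ Z, Z ∈ F' ↔ ∃ Y ∈ F, ∃ s : Finset Λ, ∀ x ∈ Y, s ⊆ t x → x ∈ Z :=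
      fun Z => Iff.rfl
    refine ⟨(F', {A0}), ?_, ?_, Or.inr ⟨t, ?_, ?_⟩⟩
    · intro Y hY
      exact (hF' Y).2 ⟨Y, hY, ∅, fun x hx _ => hx⟩
    · intro Z hZ D hD g
      obtain ⟨Y, hY, s, hs⟩ := (hF' Z).1 hZ
      have hA0D : A0 ∉ D := fun hh => hD A0 hh (Or.inr (by simp))
      obtain ⟨x, hx, hps, hx'⟩ := h s Y hY (insert A0 D) (by
        intro A hA
        rcases Finset.mem_insert.1 hA with rfl | hA
        · exact hA0
        · exact fun hAR => hD A hA (Or.inl hAR)) (Function.update g A0 s)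
      have h0 : f A0 x = s := by
        rw [hx' A0 (Finset.mem_insert_self _ _), Function.update_self]
      have ht : t x = s := by
        simp only [t, h0, if_pos hps]
      refine ⟨x, hs x hx ht.ge, ?_⟩
      intro A hA
      rw [hx' A (Finset.mem_insert_of_mem hA), Function.update_of_ne]
      rintro rfl
      exact hA0D hA
    · intro x
      by_cases hx : x ∈ p (f A0 x)
      · left
        simp only [t, if_pos hx]
        exact hx
      · right
        simp only [t, if_neg hx]
    · intro α
      exact (hF' _).2 ⟨Set.univ, Filter.univ_mem, {α}, fun x _ hx => hx (by simp)⟩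

/-- The transfinite construction. -/
lemma construct {X Λ Q W : Type} [LinearOrder W] [WellFoundedLT W] (f : Q → X → Finset Λ)
    (h0 : Cons f (⊤ : Filter X) ∅)
    (hsmall : ∀ (w : W) (r : W → Finset Q), ∃ A, A ∉ ⋃ u ∈ Set.Iio w, (r u : Set Q))
    (p : W → Finset Λ → Set X) (hp : ∀ w, Antitone (p w)) :
    ∃ E : Filter X, E.NeBot ∧ ∀ w, Decides (p w) E := by
  classical
  let Good : W → Filter X → Set Q → Filter X × Finset Q → Prop := fun w F R S =>
    S.1 ≤ F ∧ Cons f S.1 (R ∪ ↑S.2) ∧ Decides (p w) S.1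
  let nxt : W → Filter X → Set Q → Filter X × Finset Q := fun w F R =>
    if h : ∃ S, Good w F R S then h.choose else (⊤, ∅)
  have hnxt : ∀ w F R, (∃ S, Good w F R S) → Good w F R (nxt w F R) := by
    intro w F R h
    simp only [nxt, dif_pos h]
    exact h.choose_spec
  have wf : WellFounded (fun a b : W => a < b) := wellFounded_lt
  let st : W → Filter X × Finset Q := wf.fix (fun w prev =>
    nxt w (⨅ u : Set.Iio w, (prev u.1 u.2).1) (⋃ u : Set.Iio w, ((prev u.1 u.2).2 : Set Q)))
  have hst : ∀ w, st w = nxt w (⨅ u ∈ Set.Iio w, (st u).1)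
      (⋃ u ∈ Set.Iio w, ((st u).2 : Set Q)) := by
    intro w
    have := wf.fix_eq (fun w (prev : (u : W) → u < w → Filter X × Finset Q) =>
      nxt w (⨅ u : Set.Iio w, (prev u.1 u.2).1) (⋃ u : Set.Iio w, ((prev u.1 u.2).2 : Set Q))) w
    rw [iInf_subtype', Set.biUnion_eq_iUnion]
    exact this
  let P : W → Prop := fun w => Good w (⨅ u ∈ Set.Iio w, (st u).1)
      (⋃ u ∈ Set.Iio w, ((st u).2 : Set Q)) (st w)
  have key : ∀ S : Set W, (∀ u ∈ S, ∀ v < u, v ∈ S) → (∀ u ∈ S, P u) →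
      Cons f (⨅ u ∈ S, (st u).1) (⋃ u ∈ S, ((st u).2 : Set Q)) := by
    intro S hS hP
    rcases S.eq_empty_or_nonempty with rfl | hne
    · simpa using h0
    · have hmono : ∀ u ∈ S, ∀ v ∈ S, v ≤ u → (st u).1 ≤ (st v).1 := by
        intro u hu v hv hvu
        rcases hvu.eq_or_lt with rfl | hlt
        · exact le_rfl
        · exact (hP u hu).1.trans (iInf₂_le v hlt)
      intro Y hY D hD g
      rw [Filter.mem_biInf_of_directed _ hne] at hY
      · obtain ⟨u, hu, hYu⟩ := hY
        refine (hP u hu).2.1 Y hYu D ?_ g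
        intro A hA hAR
        apply hD A hA
        rcases hAR with hAR | hAR
        · simp only [Set.mem_iUnion] at hAR ⊢
          obtain ⟨v, hv, hAv⟩ := hAR
          exact ⟨v, hS u hu v hv, hAv⟩
        · simp only [Set.mem_iUnion]
          exact ⟨u, hu, hAR⟩
      · intro u hu v hv
        rcases le_total u v with h | h
        · exact ⟨v, hv, hmono v hv u hu h, le_rfl⟩
        · exact ⟨u, hu, le_rfl, hmono u hu v hv h⟩
  have hall : ∀ w, P w := by
    intro w
    induction w using wf.induction with
    | _ w ih =>
      have hc := key (Set.Iio w) (fun u hu v hv => lt_trans hv hu) ih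
      have := hnxt w _ _ (step f _ _ hc (hsmall w _) (p w) (hp w))
      rw [← hst w] at this
      exact this
  refine ⟨⨅ u ∈ Set.univ, (st u).1, ?_, ?_⟩
  · have hc := key Set.univ (fun _ _ _ _ => trivial) (fun u _ => hall u)
    rw [Filter.neBot_iff]
    intro hbot
    obtain ⟨x, hx, -⟩ := hc ∅ (by rw [hbot]; exact Filter.mem_bot) ∅ (by simp) (fun _ => ∅)
    exact hx
  · intro w
    exact (hall w).2.2.mono (iInf₂_le w trivial)

/-- Kunen's theorem. -/
theorem kunen (Λ : Type) [Infinite Λ] :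
    ∃ X : Type, Cardinal.mk X = Cardinal.mk Λ ∧ ∃ E : Filter X, E.NeBot ∧
      ∀ p : Finset Λ → Set X, Antitone p → Decides p E := by
  classical
  obtain ⟨X, f, hX, hf⟩ := exists_independent Λ
  refine ⟨X, hX, ?_⟩
  have hinf : ℵ₀ ≤ Cardinal.mk Λ := Cardinal.aleph0_le_mk Λ
  let c : Cardinal := Cardinal.mk (Set Λ)
  have hc0 : ℵ₀ < c := by
    show ℵ₀ < Cardinal.mk (Set Λ)
    rw [Cardinal.mk_set]
    exact hinf.trans_lt (Cardinal.cantor _)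
  have hT : Cardinal.mk (Finset Λ → Set X) = c := by
    show _ = Cardinal.mk (Set Λ)
    rw [← Cardinal.power_def, Cardinal.mk_set, Cardinal.mk_set, hX,
      Cardinal.mk_finset_of_infinite, ← Cardinal.power_mul, Cardinal.mul_eq_self hinf]
  let W := c.ord.ToType
  have hW : Cardinal.mk W = c := Cardinal.mk_ord_toType c
  obtain ⟨e⟩ := Cardinal.eq.1 (hW.trans hT.symm)
  have hsmall : ∀ (w : W) (r : W → Finset (Set Λ)),
      ∃ A, A ∉ ⋃ u ∈ Set.Iio w, (r u : Set (Set Λ)) := by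
    intro w r
    by_contra hcon
    push Not at hcon
    have huniv : (⋃ u ∈ Set.Iio w, (r u : Set (Set Λ))) = Set.univ :=
      Set.eq_univ_of_forall hcon
    have hlt : Cardinal.mk (Set.Iio w) < c := by
      simpa [W] using Cardinal.mk_Iio_lt w
    have h1 : Cardinal.mk (⋃ u ∈ Set.Iio w, (r u : Set (Set Λ)) : Set (Set Λ)) ≤
        Cardinal.mk (Set.Iio w) * ℵ₀ := by
      refine (Cardinal.mk_biUnion_le _ _).trans ?_
      gcongr
      apply ciSup_le'
      intro u
      exact (Cardinal.lt_aleph0_of_finite _).le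
    rw [huniv, Cardinal.mk_univ] at h1
    exact absurd (h1.trans_lt (Cardinal.mul_lt_of_lt hc0.le hlt hc0)) (lt_irrefl _)
  obtain ⟨E, hE, hdec⟩ := construct (W := W) f hf hsmall
    (fun w => if Antitone (e w) then e w else fun _ => ∅) (by
      intro w
      split_ifs with h
      · exact h
      · exact fun _ _ _ => le_rfl)
  refine ⟨E, hE, fun p hp => ?_⟩
  have := hdec (e.symm p)
  simpa [hp] using this

lemma exists_ultra {B : Type} [CompleteBooleanAlgebra B] (a : B) (ha : a ≠ ⊥) :
    ∃ U : Set B, IsBUltrafilter U ∧ a ∈ U := by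
  obtain ⟨J, hJ, -, hd⟩ := DistribLattice.prime_ideal_of_disjoint_filter_ideal
    (F := Order.PFilter.principal a) (I := Order.Ideal.principal (⊥ : B)) (by
      rw [Set.disjoint_left]
      intro x hx hx'
      have h1 : a ≤ x := hx
      have h2 : x = ⊥ := le_bot_iff.1 hx'
      exact ha (le_bot_iff.1 (h2 ▸ h1)))
  have haJ : a ∉ J := fun h => Set.disjoint_left.1 hd (show a ∈ Order.PFilter.principal a by simp) h
  refine ⟨{b | b ∉ J}, ⟨⟨?_, ?_, ?_, ?_⟩, ?_⟩, haJ⟩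
  · exact fun h => haJ (J.lower le_top h)
  · exact fun h => h J.bot_mem
  · exact fun b c hb hbc hc => hb (J.lower hbc hc)
  · intro b c hb hc h
    rcases hJ.mem_or_mem h with h | h
    · exact hb h
    · exact hc h
  · intro b
    by_contra hcon
    simp only [Set.mem_ofPred_eq, not_or, not_not] at hcon
    apply haJ
    have : b ⊔ bᶜ ∈ J := J.sup_mem hcon.1 hcon.2
    rw [sup_compl_eq_top] at this
    exact J.lower le_top this

end KunenAux

/-- **Existence of nonprincipal `λ⁺`-good ultrafilters** (Corollary 0.8). -/
theorem stmt16_good_ultrafilters_exist (lam : Cardinal) (hlam : ℵ₀ ≤ lam)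
    (B : Type) [CompleteBooleanAlgebra B]
    (hanti : ∃ S : Set B, IsBAntichain S ∧ Cardinal.mk ↥S = lam) :
    ∃ U : Set B, IsBUltrafilter U ∧ IsGoodFilter U lam ∧
      ¬∃ a : B, a ≠ ⊥ ∧ U = {b : B | a ≤ b} := by
  classical
  obtain ⟨S, ⟨hS0, hSd⟩, hScard⟩ := hanti
  have hout : Cardinal.mk (Quotient.out lam) = lam := Cardinal.mk_out lam
  haveI : Infinite (Quotient.out lam) := Cardinal.infinite_iff.2 (by rw [hout]; exact hlam)
  obtain ⟨X, hX, E, hE, hdec⟩ := KunenAux.kunen (Quotient.out lam)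
  obtain ⟨e⟩ := Cardinal.eq.1 ((hX.trans hout).trans hScard.symm)
  let a : X → B := fun x => (e x : B)
  have ha0 : ∀ x, a x ≠ ⊥ := fun x => hS0 _ (e x).2
  have had : ∀ x y, x ≠ y → a x ⊓ a y = ⊥ := fun x y hxy =>
    hSd (e x).2 (e y).2 (fun h => hxy (e.injective (Subtype.ext h)))
  choose V hV haV using fun x => KunenAux.exists_ultra (a x) (ha0 x)
  have hVtop : ∀ x, ⊤ ∈ V x := fun x => (hV x).1.1
  have hVbot : ∀ x, ⊥ ∉ V x := fun x => (hV x).1.2.1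
  have hVup : ∀ x, ∀ b c : B, b ∈ V x → b ≤ c → c ∈ V x := fun x => (hV x).1.2.2.1
  have hVinf : ∀ x, ∀ b c : B, b ∈ V x → c ∈ V x → b ⊓ c ∈ V x := fun x => (hV x).1.2.2.2
  let U : Set B := {b | {x | b ∈ V x} ∈ E}
  have hU : ∀ b, b ∈ U ↔ {x | b ∈ V x} ∈ E := fun b => Iff.rfl
  have hUtop : ⊤ ∈ U := by
    rw [hU]
    exact Filter.mem_of_superset Filter.univ_mem (fun x _ => hVtop x)
  have hUbot : ⊥ ∉ U := by
    intro h
    rw [hU] at h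
    obtain ⟨x, hx⟩ := Filter.nonempty_of_mem h
    exact hVbot x hx
  have hUup : ∀ b c : B, b ∈ U → b ≤ c → c ∈ U := fun b c hb hbc =>
    Filter.mem_of_superset hb (fun x hx => hVup x b c hx hbc)
  have hUinf : ∀ b c : B, b ∈ U → c ∈ U → b ⊓ c ∈ U := fun b c hb hc =>
    Filter.mem_of_superset (Filter.inter_mem hb hc) (fun x hx => hVinf x b c hx.1 hx.2)
  have hEultra : ∀ Y : Set X, Y ∈ E ∨ Yᶜ ∈ E := by
    intro Y
    rcases hdec (fun s => if s = ∅ then Set.univ else Y) (by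
      intro s t hst
      dsimp only
      split_ifs with h1 h2 h2
      · exact le_rfl
      · subst h1
        exact absurd (Finset.subset_empty.1 hst) h2
      · exact Set.subset_univ _
      · exact le_rfl) with ⟨s, hs⟩ | ⟨t, ht, ht'⟩
    · right
      by_cases h : s = ∅
      · simp only [h, if_true, Set.compl_univ] at hs
        exact Filter.mem_of_superset hs (Set.empty_subset _)
      · simpa only [h, if_false] using hs
    · left
      refine Filter.mem_of_superset (ht' (Classical.arbitrary _)) ?_
      intro x hx
      have hne : t x ≠ ∅ := Finset.ne_empty_of_mem hx
      simpa [hne] using ht x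
  refine ⟨U, ⟨⟨hUtop, hUbot, hUup, hUinf⟩, ?_⟩, ?_, ?_⟩
  · intro b
    rcases hEultra {x | b ∈ V x} with h | h
    · exact Or.inl h
    · right
      refine Filter.mem_of_superset h ?_
      intro x hx
      exact ((hV x).2 b).resolve_left hx
  · intro A hA hAU
    obtain ⟨hA0, -, hAm⟩ := hA
    rcases hdec (fun s => {x | A s ∈ V x}) (by
      intro s t hst x hx
      exact hVup x _ _ hx (hAm s t hst)) with ⟨s, hs⟩ | ⟨t, ht, ht'⟩
    · exfalso
      obtain ⟨x, hx, hx'⟩ := Filter.nonempty_of_mem (Filter.inter_mem hs (hAU s))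
      exact hx hx'
    · let C : Quotient.out lam → B := fun α => ⨆ x, ⨆ _ : α ∈ t x, a x ⊓ A (t x)
      have hCU : ∀ α, C α ∈ U := by
        intro α
        refine Filter.mem_of_superset (ht' α) ?_
        intro x hx
        have hne : t x ≠ ∅ := Finset.ne_empty_of_mem hx
        have hAx : A (t x) ∈ V x := (ht x).resolve_right hne
        exact hVup x _ _ (hVinf x _ _ (haV x) hAx) (le_iSup₂_of_le x hx le_rfl)
      have hCsU : ∀ s : Finset (Quotient.out lam), s.inf C ∈ U := by
        intro s
        induction s using Finset.induction_on with
        | empty => simpa using hUtop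
        | insert α s _ ih =>
          rw [Finset.inf_insert]
          exact hUinf _ _ (hCU α) ih
      refine ⟨fun s => s.inf C, ⟨by simp, ?_, ?_⟩, ?_, hCsU, ?_⟩
      · intro s h
        exact hUbot (h ▸ hCsU s)
      · intro s u hsu
        exact Finset.inf_mono hsu
      · intro s
        simp
      · intro s
        rcases s.eq_empty_or_nonempty with rfl | ⟨α, hα⟩
        · rw [hA0]
          exact le_top
        · have h1 : s.inf C ≤ C α ⊓ s.inf C := le_inf (Finset.inf_le hα) le_rfl
          refine h1.trans ?_
          simp only [C, iSup_inf_eq]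
          refine iSup₂_le fun x hx => ?_
          by_cases hs : s ⊆ t x
          · exact (inf_le_left.trans inf_le_right).trans (hAm _ _ hs)
          · obtain ⟨β, hβ, hβt⟩ := Finset.not_subset.1 hs
            have h2 : a x ⊓ C β = ⊥ := by
              rw [← le_bot_iff]
              simp only [C, inf_iSup_eq]
              refine iSup₂_le fun y hy => ?_
              have hxy : x ≠ y := by
                rintro rfl
                exact hβt hy
              rw [← had x y hxy]
              exact inf_le_inf_left _ inf_le_left
            refine le_trans ?_ (bot_le (a := A s))
            rw [← h2]
            exact inf_le_inf inf_le_left (Finset.inf_le hβ)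
  · rintro ⟨b, hb, hUb⟩
    have hbU : b ∈ U := by
      rw [hUb]
      exact le_refl b
    rcases hdec (fun _ => Set.univ) (fun _ _ _ => le_rfl) with ⟨s, hs⟩ | ⟨t, -, ht'⟩
    · obtain ⟨x, hx⟩ := Filter.nonempty_of_mem hs
      exact hx trivial
    · have hnot : ∀ x, (a x)ᶜ ∈ U := by
        intro x
        obtain ⟨α, hα⟩ := Infinite.exists_notMem_finset (t x)
        refine Filter.mem_of_superset (ht' α) ?_
        intro y hy
        have hyx : y ≠ x := by
          rintro rfl
          exact hα hy
        refine hVup y _ _ (haV y) ?_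
        exact (disjoint_iff.2 (had y x hyx)).le_compl_right
      obtain ⟨x, hx⟩ := Filter.nonempty_of_mem hbU
      have h1 : b ≤ (a x)ᶜ := by
        have := hnot x
        rw [hUb] at this
        exact this
      have h2 : a x ⊓ (a x)ᶜ ∈ V x := hVinf x _ _ (haV x) (hVup x _ _ hx h1)
      rw [inf_compl_eq_bot] at h2
      exact hVbot x h2
end
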